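/- Let f be an endomorphism of A₁, and suppose there exist involutions γ and δ on A₁, each conjugate to α, such that f ∘ γ = δ ∘ f. Then f is an automorphism of A₁. -/

import Mathlib

noncomputable section

/-- `f : A → A` is a `K`-algebra endomorphism (as a bare function). -/
def IsAlgEndo (K : Type) [CommSemiring K] {A : Type} [Semiring A] [Algebra K A]
    (f : A → A) : Prop :=
  (∀ a b : A, f (a + b) = f a + f b) ∧
  (∀ (c : K) (a : A), f (c • a) = c • f a) ∧
  (∀ a b : A, f (a * b) = f a * f b) ∧ f 1 = 1

/-- `f : A → A` is a `K`-algebra automorphism: a bijective endomorphism. -/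
def IsAlgAuto (K : Type) [CommSemiring K] {A : Type} [Semiring A] [Algebra K A]
    (f : A → A) : Prop :=
  IsAlgEndo K f ∧ Function.Bijective f

/-- `f : A → A` is a `K`-linear anti-endomorphism. -/
def IsAntiEndo (K : Type) [CommSemiring K] {A : Type} [Semiring A] [Algebra K A]
    (f : A → A) : Prop :=
  (∀ a b : A, f (a + b) = f a + f b) ∧
  (∀ (c : K) (a : A), f (c • a) = c • f a) ∧
  (∀ a b : A, f (a * b) = f b * f a) ∧ f 1 = 1

/-- `f : A → A` is an anti-automorphism: a bijective anti-endomorphism. -/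
def IsAntiAuto (K : Type) [CommSemiring K] {A : Type} [Semiring A] [Algebra K A]
    (f : A → A) : Prop :=
  IsAntiEndo K f ∧ Function.Bijective f

/-- An involution on a `K`-algebra: an anti-automorphism of order at most two. -/
def IsInvolutionOn (K : Type) [CommSemiring K] {A : Type} [Semiring A] [Algebra K A]
    (γ : A → A) : Prop :=
  IsAntiAuto K γ ∧ γ ∘ γ = id

/-- The defining relation of the first Weyl algebra: `Y*X = X*Y + 1`. -/
inductive WeylRel (K : Type) [CommSemiring K] :
    FreeAlgebra K (Fin 2) → FreeAlgebra K (Fin 2) → Prop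
  | rel : WeylRel K (FreeAlgebra.ι K 1 * FreeAlgebra.ι K 0)
      (FreeAlgebra.ι K 0 * FreeAlgebra.ι K 1 + 1)

/-- The first Weyl algebra `A₁(K) = K⟨X,Y⟩/(YX - XY - 1)`. -/
abbrev Weyl (K : Type) [CommSemiring K] : Type := RingQuot (WeylRel K)

/-- The generator `X` of the Weyl algebra. -/
def Wx (K : Type) [CommSemiring K] : Weyl K :=
  RingQuot.mkAlgHom K (WeylRel K) (FreeAlgebra.ι K 0)

/-- The generator `Y` of the Weyl algebra. -/
def Wy (K : Type) [CommSemiring K] : Weyl K :=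
  RingQuot.mkAlgHom K (WeylRel K) (FreeAlgebra.ι K 1)

/-- `α` is the exchange involution: the involution with `α X = Y` and `α Y = X`. -/
def IsExchange (K : Type) [CommSemiring K] (α : Weyl K → Weyl K) : Prop :=
  IsInvolutionOn K α ∧ α (Wx K) = Wy K ∧ α (Wy K) = Wx K

/-- `γ` is conjugate to `α` by an automorphism or an anti-automorphism:
`γ = g⁻¹ ∘ α ∘ g`. -/
def ConjToAlpha (K : Type) [CommSemiring K] (α γ : Weyl K → Weyl K) : Prop :=
  ∃ g : Weyl K → Weyl K, (IsAlgAuto K g ∨ IsAntiAuto K g) ∧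
    γ = Function.invFun g ∘ α ∘ g


section Basics

open Polynomial

variable {R : Type} [CommRing R]

theorem W_rel (R : Type) [CommRing R] : Wy R * Wx R = Wx R * Wy R + 1 := by
  have := RingQuot.mkAlgHom_rel R (WeylRel.rel (K := R))
  simpa [Wx, Wy] using this

/-- universal property -/
def Wlift {B : Type} [Ring B] [Algebra R B] (a b : B) (h : b * a = a * b + 1) :
    Weyl R →ₐ[R] B :=
  RingQuot.liftAlgHom R ⟨FreeAlgebra.lift R ![a, b], by
    rintro _ _ ⟨⟩
    simpa using h⟩

@[simp] theorem Wlift_x {B : Type} [Ring B] [Algebra R B] (a b : B) (h : b * a = a * b + 1) :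
    Wlift (R := R) a b h (Wx R) = a := by
  simp [Wlift, Wx]

@[simp] theorem Wlift_y {B : Type} [Ring B] [Algebra R B] (a b : B) (h : b * a = a * b + 1) :
    Wlift (R := R) a b h (Wy R) = b := by
  simp [Wlift, Wy]

theorem W_ext {B : Type} [Ring B] [Algebra R B] {f g : Weyl R →ₐ[R] B}
    (hx : f (Wx R) = g (Wx R)) (hy : f (Wy R) = g (Wy R)) : f = g := by
  apply RingQuot.ringQuot_ext'
  apply FreeAlgebra.hom_ext
  funext i
  fin_cases i
  · exact hx
  · exact hy

theorem W_adjoin : Algebra.adjoin R {Wx R, Wy R} = ⊤ := by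
  set A := Algebra.adjoin R {Wx R, Wy R}
  have hx : Wx R ∈ A := Algebra.subset_adjoin (by simp)
  have hy : Wy R ∈ A := Algebra.subset_adjoin (by simp)
  let φ : Weyl R →ₐ[R] A := Wlift (B := A) (⟨Wx R, hx⟩ : A) (⟨Wy R, hy⟩ : A) (by
    apply Subtype.ext; simpa using W_rel R)
  have : A.val.comp φ = AlgHom.id R _ := W_ext (by simp [φ]) (by simp [φ])
  rw [eq_top_iff]
  intro a _
  have h := DFunLike.congr_fun this a
  simp only [AlgHom.comp_apply, AlgHom.id_apply] at h
  rw [← h]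
  exact (φ a).2

theorem comm_pow {B : Type} [Ring B] (p q : B) (h : q * p = p * q + 1) (m : ℕ) :
    q * p ^ m = p ^ m * q + m • p ^ (m - 1) := by
  induction m with
  | zero => simp
  | succ m ih =>
    rw [pow_succ, ← mul_assoc, ih, add_mul, mul_assoc, h]
    rcases m with _ | m
    · simp
    · simp only [Nat.add_sub_cancel, smul_mul_assoc, ← pow_succ]
      rw [mul_add, ← mul_assoc, mul_one, add_assoc, ← succ_nsmul', ← pow_succ]

/-- normal ordering coefficient -/
def nc (j k n : ℕ) : ℕ := n.factorial * j.choose n * k.choose n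

theorem nc_succ (j k n : ℕ) : nc (j+1) k (n+1) = nc j k (n+1) + (k - n) * nc j k n := by
  unfold nc
  have h := Nat.choose_succ_right_eq k n
  rw [Nat.choose_succ_succ, Nat.factorial_succ]
  calc (n+1) * n.factorial * (j.choose n + j.choose (n+1)) * k.choose (n+1)
      = (n+1) * n.factorial * j.choose (n+1) * k.choose (n+1)
        + n.factorial * j.choose n * (k.choose (n+1) * (n+1)) := by ring
    _ = _ := by rw [h]; ring

theorem normal_order {B : Type} [Ring B] (p q : B) (h : q * p = p * q + 1) (j k : ℕ) :
    q ^ j * p ^ k = ∑ n ∈ Finset.range (j+1), nc j k n • (p ^ (k - n) * q ^ (j - n)) := by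
  induction j with
  | zero => simp [nc]
  | succ j ih =>
    rw [pow_succ', mul_assoc, ih, Finset.mul_sum]
    have e1 : ∀ n ∈ Finset.range (j+1), q * (nc j k n • (p ^ (k - n) * q ^ (j - n)))
        = nc j k n • (p ^ (k-n) * q ^ (j + 1 - n))
          + ((k - n) * nc j k n) • (p ^ (k - (n+1)) * q ^ (j - n)) := by
      intro n hn
      have hn' : n ≤ j := by simpa [Nat.lt_succ_iff] using hn
      rw [mul_smul_comm, ← mul_assoc, comm_pow p q h, add_mul, smul_add, mul_assoc, ← pow_succ',
        show j - n + 1 = j + 1 - n by omega, smul_mul_assoc, smul_smul, mul_comm (nc j k n),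
        Nat.sub_sub]
    rw [Finset.sum_congr rfl e1, Finset.sum_add_distrib, Finset.sum_range_succ' _ (j+1)]
    simp only [nc_succ, add_smul, Finset.sum_add_distrib, Nat.add_sub_add_right]
    have e2 : ∑ n ∈ Finset.range (j+1), nc j k n • (p ^ (k-n) * q ^ (j + 1 - n))
       = ∑ n ∈ Finset.range (j+1), nc j k (n+1) • (p ^ (k-(n+1)) * q ^ (j - n))
         + nc (j+1) k 0 • (p ^ (k - 0) * q ^ (j+1 - 0)) := by
      have : nc (j+1) k 0 = nc j k 0 := by simp [nc]
      rw [this]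
      have h3 := Finset.sum_range_succ' (fun n => nc j k n • (p ^ (k-n) * q ^ (j + 1 - n))) (j+1)
      rw [Finset.sum_range_succ] at h3
      have h4 : nc j k (j+1) = 0 := by simp [nc]
      simp only [h4, zero_smul, add_zero, Nat.add_sub_add_right] at h3
      exact h3
    rw [e2]
    abel

/-- monomials -/
def mon (R : Type) [CommRing R] (u : ℕ × ℕ) : Weyl R := Wx R ^ u.1 * Wy R ^ u.2

theorem mon_mul (u v : ℕ × ℕ) : mon R u * mon R v =
    ∑ n ∈ Finset.range (u.2 + 1), nc u.2 v.1 n • mon R (u.1 + v.1 - n, u.2 + v.2 - n) := by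
  unfold mon
  rw [show Wx R ^ u.1 * Wy R ^ u.2 * (Wx R ^ v.1 * Wy R ^ v.2) =
    Wx R ^ u.1 * (Wy R ^ u.2 * Wx R ^ v.1) * Wy R ^ v.2 by simp only [mul_assoc],
    normal_order _ _ (W_rel R), Finset.mul_sum, Finset.sum_mul]
  apply Finset.sum_congr rfl
  intro n hn
  have hn' : n ≤ u.2 := by simpa [Nat.lt_succ_iff] using hn
  by_cases hv : n ≤ v.1
  · rw [mul_smul_comm, smul_mul_assoc, ← mul_assoc, ← pow_add, mul_assoc, ← pow_add,
      Nat.add_sub_assoc hv, Nat.sub_add_comm hn']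
  · have : nc u.2 v.1 n = 0 := by
      simp [nc, Nat.choose_eq_zero_of_lt (not_le.mp hv)]
    simp [this]

/-- the linear combination map -/
def Φ (R : Type) [CommRing R] : (ℕ × ℕ →₀ R) →ₗ[R] Weyl R := Finsupp.linearCombination R (mon R)

theorem mon_mem (u : ℕ × ℕ) : mon R u ∈ LinearMap.range (Φ R) :=
  ⟨Finsupp.single u 1, by simp [Φ]⟩

theorem Φ_range_mul (a : Weyl R) : ∀ r ∈ LinearMap.range (Φ R), a * r ∈ LinearMap.range (Φ R) := by
  have ha : a ∈ Algebra.adjoin R {Wx R, Wy R} := by rw [W_adjoin]; trivial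
  have key : ∀ u v, mon R u * mon R v ∈ LinearMap.range (Φ R) := by
    intro u v
    rw [mon_mul]
    exact Submodule.sum_mem _ fun n _ => nsmul_mem (mon_mem _) _
  have key2 : ∀ u, ∀ r ∈ LinearMap.range (Φ R), mon R u * r ∈ LinearMap.range (Φ R) := by
    rintro u _ ⟨c, rfl⟩
    induction c using Finsupp.induction_linear with
    | zero => simp
    | add f g hf hg => rw [map_add, mul_add]; exact Submodule.add_mem _ hf hg
    | single v c => simpa [Φ] using Submodule.smul_mem _ c (key u v)
  induction ha using Algebra.adjoin_induction with
  | mem x hx =>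
    rcases hx with rfl | rfl
    · simpa [mon] using key2 (1, 0)
    · simpa [mon] using key2 (0, 1)
  | algebraMap c =>
    intro r hr
    rw [← Algebra.smul_def]
    exact Submodule.smul_mem _ _ hr
  | add x y _ _ hx hy =>
    intro r hr
    rw [add_mul]
    exact Submodule.add_mem _ (hx r hr) (hy r hr)
  | mul x y _ _ hx hy =>
    intro r hr
    rw [mul_assoc]
    exact hx _ (hy r hr)

theorem Φ_surj : Function.Surjective (Φ R) := by
  intro a
  have := Φ_range_mul a 1 (by simpa [mon] using mon_mem (R := R) (0,0))
  simpa using this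

/-- action on polynomials -/
def act (R : Type) [CommRing R] : Weyl R →ₐ[R] Module.End R R[X] :=
  Wlift (LinearMap.mulLeft R X) (Polynomial.derivative) (by
    refine LinearMap.ext fun f => ?_
    simp [Polynomial.derivative_mul, add_comm])

theorem act_x (f : R[X]) : act R (Wx R) f = X * f := by simp [act]
theorem act_y (f : R[X]) : act R (Wy R) f = derivative f := by simp [act]

theorem act_mon (u : ℕ × ℕ) (f : R[X]) : act R (mon R u) f = X ^ u.1 * derivative^[u.2] f := by
  have hx : ∀ (n : ℕ) (g : R[X]), (act R (Wx R) ^ n) g = X ^ n * g := by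
    intro n
    induction n with
    | zero => simp
    | succ n ih => intro g; rw [pow_succ', Module.End.mul_apply, ih, act_x]; ring
  have hy : ∀ (n : ℕ) (g : R[X]), (act R (Wy R) ^ n) g = derivative^[n] g := by
    intro n
    induction n with
    | zero => simp
    | succ n ih =>
      intro g; rw [pow_succ', Module.End.mul_apply, ih, act_y, Function.iterate_succ_apply']
  rw [mon, map_mul, map_pow, map_pow, Module.End.mul_apply, hx, hy]

theorem act_mon_X (u : ℕ × ℕ) (n : ℕ) : act R (mon R u) (X ^ n) =
    C (n.descFactorial u.2 : R) * X ^ (u.1 + (n - u.2)) := by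
  rw [act_mon, Polynomial.iterate_derivative_X_pow_eq_natCast_mul]
  rw [pow_add, ← Polynomial.C_eq_natCast]; ring

theorem act_Φ (c : ℕ × ℕ →₀ R) (f : R[X]) :
    act R (Φ R c) f = c.sum fun u a => a • act R (mon R u) f := by
  simp only [Φ, Finsupp.linearCombination_apply, Finsupp.sum, map_sum, map_smul,
    LinearMap.sum_apply, LinearMap.smul_apply]

theorem Φ_inj [IsDomain R] [CharZero R] : Function.Injective (Φ R) := by
  rw [injective_iff_map_eq_zero]
  intro c hc
  have key : ∀ j i, c (i, j) = 0 := by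
    intro j
    induction j using Nat.strong_induction_on with
    | _ j ih =>
    intro i
    have h1 : act R (Φ R c) (X ^ j) = 0 := by rw [hc]; simp
    rw [act_Φ] at h1
    have h2 := congrArg (fun f => f.coeff i) h1
    simp only [Finsupp.sum, Polynomial.finsetSum_coeff, Polynomial.coeff_smul, act_mon_X,
      Polynomial.coeff_C_mul, Polynomial.coeff_X_pow, Polynomial.coeff_zero, smul_eq_mul] at h2
    rw [Finset.sum_eq_single (i, j)] at h2
    · simpa [Nat.descFactorial_self, Nat.factorial_ne_zero] using h2
    · rintro ⟨a, b⟩ hb hne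
      rcases lt_trichotomy b j with h | h | h
      · rw [ih b h]; simp
      · subst h
        have : i ≠ a := fun h => hne (by rw [h])
        simp [this]
      · simp [Nat.descFactorial_eq_zero_iff_lt.mpr h]
    · intro h
      simp [Finsupp.notMem_support_iff.mp h]
  ext ⟨i, j⟩
  exact key j i

end Basics
section ModP

open Polynomial Matrix

theorem charpoly_deriv {B : Type} [CommRing B] {n : Type} [Fintype n] [DecidableEq n]
    (P Q : Matrix n n B) (h : Q * P = P * Q + 1) : derivative Q.charpoly = 0 := by
  let i : B →+* DualNumber B := algebraMap B (DualNumber B)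
  let P1 : Matrix n n (DualNumber B) := P.map i
  let Q1 : Matrix n n (DualNumber B) := Q.map i
  have h1 : Q1 * P1 = P1 * Q1 + 1 := by
    have := congrArg (fun M => M.map i) h
    simpa [P1, Q1, Matrix.map_mul, Matrix.map_add, i] using this
  let e : DualNumber B := DualNumber.eps
  have he : e * e = 0 := DualNumber.eps_mul_eps
  let U : (Matrix n n (DualNumber B))ˣ :=
    ⟨1 + e • P1, 1 - e • P1, by
      simp [add_mul, mul_sub, smul_smul, he], by
      simp [mul_add, sub_mul, smul_smul, he]⟩
  have hU : U.val * Q1 * U⁻¹.val = Q1 - scalar n e := by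
    have : scalar n e = e • (1 : Matrix n n (DualNumber B)) := by
      rw [Matrix.smul_one_eq_diagonal]; rfl
    rw [this]
    change (1 + e • P1) * Q1 * (1 - e • P1) = _
    simp only [add_mul, mul_sub, one_mul, mul_one, smul_mul_assoc, mul_smul_comm, smul_smul, he,
      zero_smul, mul_assoc, h1, smul_add]
    abel
  have h2 := Matrix.charpoly_units_conj U Q1
  rw [← Matrix.coe_units_inv, hU, Matrix.charpoly_sub_scalar] at h2
  have h3 : Q1.charpoly = Q.charpoly.map i := Matrix.charpoly_map Q i
  rw [h3] at h2
  have h4 : (Q.charpoly.map i).comp (X + C e) = Q.charpoly.map i +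
      (derivative (Q.charpoly.map i)) * C e := by
    have := Polynomial.aeval_add_of_sq_eq_zero (Q.charpoly.map i) (X : (DualNumber B)[X]) (C e)
      (by rw [← C_pow, pow_two, he, C_0])
    simpa [Polynomial.comp, Polynomial.aeval_def] using this
  rw [h4] at h2
  have h5 : derivative (Q.charpoly.map i) * C e = 0 := by simpa using h2
  ext k
  have h6 := congrArg (fun f => TrivSqZeroExt.snd (f.coeff k)) h5
  rw [Polynomial.derivative_map] at h6
  simpa [i, e, TrivSqZeroExt.algebraMap_eq_inl] using h6

theorem unit_modp {B : Type} [CommRing B] (p m : ℕ) [Fact p.Prime] [CharP B p]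
    (h0 : 0 < m) (hm : m < p) : IsUnit (m : B) := by
  have hp : p.Prime := Fact.out
  have hc : Nat.Coprime m p := (hp.coprime_iff_not_dvd.mpr (Nat.not_dvd_of_pos_of_lt h0 hm)).symm
  have := (ZMod.unitOfCoprime m hc).isUnit.map (ZMod.castHom (dvd_refl p) B)
  simpa using this

theorem charpoly_modp {B : Type} [CommRing B] [Nontrivial B] (p : ℕ) [Fact p.Prime] [CharP B p]
    (P Q : Matrix (Fin p) (Fin p) B) (h : Q * P = P * Q + 1) :
    Q ^ p = (-Q.charpoly.coeff 0) • 1 := by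
  have hd := charpoly_deriv P Q h
  have hdeg : Q.charpoly.natDegree = p := by simp [Matrix.charpoly_natDegree_eq_dim]
  have hmon := Matrix.charpoly_monic Q
  have hp : p.Prime := Fact.out
  have h1 : Q.charpoly = X ^ p + C (Q.charpoly.coeff 0) := by
    ext k
    rcases Nat.eq_zero_or_pos k with rfl | hk
    · simp [coeff_X_pow, hp.ne_zero.symm]
    · rw [coeff_add, coeff_X_pow, coeff_C, if_neg hk.ne', add_zero]
      split_ifs with hkp
      · have := hmon.coeff_natDegree
        rw [hdeg] at this; rw [hkp]; exact this
      · rcases lt_or_gt_of_ne hkp with hl | hl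
        · obtain ⟨m, rfl⟩ : ∃ m, k = m + 1 := ⟨k - 1, by omega⟩
          have h2 := congrArg (fun f => f.coeff m) hd
          simp only [coeff_derivative, coeff_zero] at h2
          have hu : IsUnit (((m + 1 : ℕ)) : B) := unit_modp p (m+1) (by omega) hl
          push_cast at hu
          exact (hu.mul_left_eq_zero).mp h2
        · exact coeff_eq_zero_of_natDegree_lt (by omega)
  have h2 := Matrix.aeval_self_charpoly Q
  rw [h1] at h2
  simp only [map_add, map_pow, aeval_X, aeval_C] at h2
  rw [eq_neg_of_add_eq_zero_left h2, Algebra.algebraMap_eq_smul_one, neg_smul]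


variable {R : Type} [CommRing R]

theorem neg_rel {B : Type} [Ring B] (p q : B) (h : q * p = p * q + 1) :
    p * (-q) = (-q) * p + 1 := by
  rw [neg_mul, h, mul_neg]; abel

/-- the antiautomorphism fixing x and negating y -/
def bet (R : Type) [CommRing R] : Weyl R →ₐ[R] (Weyl R)ᵐᵒᵖ :=
  Wlift (MulOpposite.op (Wx R)) (MulOpposite.op (-Wy R)) (by
    apply MulOpposite.unop_injective
    simpa using neg_rel _ _ (W_rel R))

/-- matrix of x -/
def Mx (R : Type) [CommRing R] (p : ℕ) : Matrix (Fin p) (Fin p) R[X] :=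
  Matrix.of fun i j => if (i:ℕ) = j + 1 then 1 else if (i:ℕ) = 0 ∧ (j:ℕ) + 1 = p then X else 0

/-- matrix of y -/
def My (R : Type) [CommRing R] (p : ℕ) : Matrix (Fin p) (Fin p) R[X] :=
  Matrix.of fun i j => if (i:ℕ) + 1 = j then ((j:ℕ) : R[X]) else 0

theorem M_rel (p : ℕ) [CharP R p] : My R p * Mx R p = Mx R p * My R p + 1 := by
  ext1 i j
  rw [Matrix.add_apply]
  have hl : (My R p * Mx R p) i j = if i = j then (((i:ℕ) + 1 : ℕ) : R[X]) else 0 := by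
    rw [Matrix.mul_apply]
    by_cases hi : (i:ℕ) + 1 < p
    · rw [Finset.sum_eq_single ⟨i+1, hi⟩]
      · by_cases hij : i = j
        · subst hij; simp [My, Mx]
        · have : ¬ (i:ℕ) = j := fun h => hij (Fin.ext h)
          simp [My, Mx, hij, this]
      · intro k _ hk
        have : ¬ (i:ℕ) + 1 = k := fun h => hk (Fin.ext h.symm)
        simp [My, this]
      · simp
    · have h1 : (i:ℕ) + 1 = p := by omega
      rw [Finset.sum_eq_zero]
      · rw [h1]; simp
      · intro k _
        have : ¬ (i:ℕ) + 1 = k := by omega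
        simp [My, this]
  have hr : (Mx R p * My R p) i j = if i = j then (((i:ℕ) : ℕ) : R[X]) else 0 := by
    rw [Matrix.mul_apply]
    by_cases hj : (j:ℕ) = 0
    · rw [Finset.sum_eq_zero]
      · split_ifs with h
        · subst h; simp [hj]
        · rfl
      · intro k _
        simp [My, hj]
    · rw [Finset.sum_eq_single ⟨j-1, by omega⟩]
      · have h1 : (j:ℕ) - 1 + 1 = j := by omega
        have h2 : ¬ (j:ℕ) = p := by omega
        by_cases hij : i = j
        · subst hij; simp [My, Mx, h1]
        · have : ¬ (i:ℕ) = j := fun h => hij (Fin.ext h)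
          simp [My, Mx, h1, h2, hij, this]
      · intro k _ hk
        have : ¬ (k:ℕ) + 1 = j := fun h => hk (Fin.ext (by simp; omega))
        simp [My, this]
      · simp
  rw [hl, hr, Matrix.one_apply]
  split_ifs <;> simp

/-- matrix representation -/
def rho (R : Type) [CommRing R] (p : ℕ) [CharP R p] : Weyl R →ₐ[R] Matrix (Fin p) (Fin p) R[X] :=
  Wlift (Mx R p) (My R p) (M_rel p)

/-- anti-transpose -/
def adjM (R : Type) [CommRing R] (p : ℕ) :
    Matrix (Fin p) (Fin p) R[X] →ₐ[R] (Matrix (Fin p) (Fin p) R[X])ᵐᵒᵖ :=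
  ((Matrix.transposeAlgEquiv (Fin p) R R[X]).toAlgHom).comp
    (Matrix.reindexAlgEquiv R R[X] Fin.revPerm).toAlgHom

theorem adjM_apply (p : ℕ) (M : Matrix (Fin p) (Fin p) R[X]) (i j : Fin p) :
    (adjM R p M).unop i j = M j.rev i.rev := by
  simp [adjM]

theorem adjM_rho (p : ℕ) [CharP R p] (a : Weyl R) :
    adjM R p (rho R p a) = MulOpposite.op (rho R p (bet R a).unop) := by
  have : (adjM R p).comp (rho R p) = (AlgHom.op (rho R p)).comp (bet R) := by
    apply W_ext
    · apply MulOpposite.unop_injective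
      ext1 i j
      rw [AlgHom.comp_apply, adjM_apply]
      have h1 : (p - (j + 1 : ℕ) = p - (i+1 : ℕ) + 1) ↔ (i:ℕ) = j + 1 := by omega
      have h2 : (p - (j + 1 : ℕ) = 0 ∧ p - (i+1 : ℕ) + 1 = p) ↔ (i:ℕ) = 0 ∧ (j:ℕ) + 1 = p := by
        omega
      simp [rho, bet, Mx, h1, h2]
    · apply MulOpposite.unop_injective
      ext1 i j
      rw [AlgHom.comp_apply, adjM_apply]
      have h1 : (p - (j + 1 : ℕ) + 1 = p - (i+1 : ℕ)) ↔ (i:ℕ) + 1 = j := by omega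
      by_cases h : (i:ℕ) + 1 = j
      · have h3 : ((p - (i+1 : ℕ) : ℕ) : R[X]) = - ((j:ℕ) : R[X]) := by
          rw [eq_neg_iff_add_eq_zero, ← Nat.cast_add, ← h,
            show p - ((i:ℕ)+1) + ((i:ℕ)+1) = p by omega]
          simp
        have h4 : rho R p (Wy R) j.rev i.rev = ((p - (i+1 : ℕ) : ℕ) : R[X]) := by
          have h5 : p - (j + 1 : ℕ) + 1 = p - (i+1 : ℕ) := h1.mpr h
          simp only [rho, My, Wlift_y, Matrix.of_apply, Fin.val_rev]
          rw [if_pos h5]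
        rw [h4, h3]
        simp [rho, bet, My, h]
      · simp [rho, bet, My, h1, h]
  exact DFunLike.congr_fun this a

theorem det_skew (p : ℕ) [Fact p.Prime] (hp2 : p ≠ 2) [CharP R p] (Q : Weyl R)
    (hQ : bet R Q = MulOpposite.op (-Q)) : (rho R p Q).det = 0 := by
  have hp : p.Prime := Fact.out
  have h1 := adjM_rho p Q
  rw [hQ] at h1
  have h2 : ((adjM R p (rho R p Q)).unop).det = (rho R p Q).det := by
    simp only [adjM, AlgHom.comp_apply]
    exact (Matrix.det_transpose _).trans (Matrix.det_reindex_self Fin.revPerm _)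
  rw [h1] at h2
  simp only [MulOpposite.unop_op, map_neg, Matrix.det_neg, Fintype.card_fin,
    (hp.odd_of_ne_two hp2).neg_one_pow] at h2
  have h3 : (rho R p Q).det * 2 = 0 := by linear_combination -h2
  have hu : IsUnit ((2:ℕ) : R[X]) := unit_modp p 2 (by norm_num) (by
    have := hp.two_le; omega)
  exact (IsUnit.mul_left_eq_zero (by exact_mod_cast hu)).mp h3

/-- intertwiner -/
def ent (R : Type) [CommRing R] (p : ℕ) : (Fin p → R[X]) →ₗ[R] R[X] where
  toFun v := ∑ a : Fin p, X ^ (a:ℕ) * expand R p (v a)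
  map_add' u v := by simp [mul_add, Finset.sum_add_distrib]
  map_smul' c v := by simp [Finset.smul_sum]

theorem ent_mulVec (p : ℕ) (M : Matrix (Fin p) (Fin p) R[X]) (v : Fin p → R[X]) :
    ent R p (M *ᵥ v) = ∑ j, (∑ i : Fin p, X ^ (i:ℕ) * expand R p (M i j)) * expand R p (v j) := by
  simp only [ent, LinearMap.coe_mk, AddHom.coe_mk, Matrix.mulVec, dotProduct, map_sum, map_mul,
    Finset.mul_sum, Finset.sum_mul]
  rw [Finset.sum_comm]
  simp only [mul_assoc]

theorem ent_rho (p : ℕ) [CharP R p] (a : Weyl R) :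
    ∀ v, ent R p (rho R p a *ᵥ v) = act R a (ent R p v) := by
  have ha : a ∈ Algebra.adjoin R {Wx R, Wy R} := by rw [W_adjoin]; trivial
  induction ha using Algebra.adjoin_induction with
  | mem x hx =>
    intro v
    rcases hx with rfl | rfl
    · rw [ent_mulVec, act_x]
      simp only [ent, LinearMap.coe_mk, AddHom.coe_mk, Finset.mul_sum]
      apply Finset.sum_congr rfl
      intro j _
      rw [← mul_assoc]
      congr 1
      by_cases hj : (j:ℕ) + 1 < p
      · rw [Finset.sum_eq_single ⟨j+1, hj⟩]
        · simp [rho, Mx]; ring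
        · intro i _ hi
          have : ¬ (i:ℕ) = j + 1 := fun h => hi (Fin.ext h)
          have h2 : ¬ (j:ℕ) + 1 = p := by omega
          simp [rho, Mx, this, h2]
        · simp
      · have h1 : (j:ℕ) + 1 = p := by omega
        rw [Finset.sum_eq_single ⟨0, by omega⟩]
        · simp only [rho, Mx, Wlift_x]
          have h0 : ¬ 0 = p := by omega
          simp [h1, h0, ← pow_succ']
        · intro i _ hi
          have : ¬ (i:ℕ) = 0 := fun h => hi (Fin.ext h)
          have h2 : ¬ (i:ℕ) = j + 1 := by omega
          simp [rho, Mx, this, h2]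
        · simp
    · rw [ent_mulVec, act_y]
      simp only [ent, LinearMap.coe_mk, AddHom.coe_mk, map_sum]
      apply Finset.sum_congr rfl
      intro j _
      rw [derivative_mul, derivative_expand]
      have hp0 : (p : R[X]) = 0 := CharP.cast_eq_zero _ _
      simp only [hp0, zero_mul, mul_zero, add_zero]
      congr 1
      rw [derivative_X_pow]
      by_cases hj : (j:ℕ) = 0
      · simp [rho, My, hj]
      · rw [Finset.sum_eq_single ⟨j-1, by omega⟩]
        · have h1 : (j:ℕ) - 1 + 1 = j := by omega
          simp [rho, My, h1]; ring
        · intro k _ hk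
          have : ¬ (k:ℕ) + 1 = j := fun h => hk (Fin.ext (by simp; omega))
          simp [rho, My, this]
        · simp
  | algebraMap c =>
    intro v
    rw [AlgHom.commutes, AlgHom.commutes, Algebra.algebraMap_eq_smul_one,
      Algebra.algebraMap_eq_smul_one, Matrix.smul_mulVec]
    simp
  | add x y _ _ hx hy =>
    intro v
    rw [map_add, map_add, Matrix.add_mulVec, map_add, hx, hy]; rfl
  | mul x y _ _ hx hy =>
    intro v
    rw [map_mul, map_mul, ← Matrix.mulVec_mulVec, hx, hy]; rfl

theorem ent_surj (p : ℕ) (hp : 0 < p) : Function.Surjective (ent R p) := by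
  rw [← LinearMap.range_eq_top, eq_top_iff]
  intro f _
  induction f using Polynomial.induction_on' with
  | add f g hf hg => exact Submodule.add_mem _ (hf trivial) (hg trivial)
  | monomial n c =>
    refine ⟨Pi.single ⟨n % p, Nat.mod_lt _ hp⟩ (C c * X ^ (n / p)), ?_⟩
    simp only [ent, LinearMap.coe_mk, AddHom.coe_mk]
    rw [Finset.sum_eq_single ⟨n % p, Nat.mod_lt _ hp⟩]
    · simp only [Pi.single_eq_same, map_mul, map_pow, expand_C, expand_X]
      rw [← C_mul_X_pow_eq_monomial, ← pow_mul, mul_left_comm, ← pow_add, Nat.mod_add_div]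
    · intro b _ hb
      simp [Pi.single_eq_of_ne hb]
    · simp

theorem modp_main (p : ℕ) [Fact p.Prime] (hp2 : p ≠ 2) [Nontrivial R] [CharP R p] (P Q : Weyl R)
    (h : Q * P = P * Q + 1) (hQ : bet R Q = MulOpposite.op (-Q)) :
    (∀ f, act R (Q ^ p) f = 0) ∧ ∃ ζ : R[X], ∀ f, act R (P ^ p) f = expand R p ζ * f := by
  have hp : p.Prime := Fact.out
  have hM : rho R p Q * rho R p P = rho R p P * rho R p Q + 1 := by
    rw [← map_mul, h]; simp
  have hM2 : rho R p P * rho R p (-Q) = rho R p (-Q) * rho R p P + 1 := by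
    rw [← map_mul, ← map_mul, neg_rel _ _ h]; simp
  have h1 := charpoly_modp p _ _ hM
  have h2 := charpoly_modp p _ _ hM2
  have hs : ∀ (c : R[X]) v, ent R p ((c • (1 : Matrix (Fin p) (Fin p) R[X])) *ᵥ v)
      = expand R p c * ent R p v := by
    intro c v
    rw [Matrix.smul_mulVec, Matrix.one_mulVec]
    simp only [ent, LinearMap.coe_mk, AddHom.coe_mk, Finset.mul_sum]
    apply Finset.sum_congr rfl
    intro i _
    simp; ring
  have hd : (rho R p Q).charpoly.coeff 0 = 0 := by
    have h3 := det_skew p hp2 Q hQ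
    rw [Matrix.det_eq_sign_charpoly_coeff] at h3
    rcases neg_one_pow_eq_or R[X] (Fintype.card (Fin p)) with h4 | h4 <;>
      simpa [h4] using h3
  constructor
  · intro f
    obtain ⟨v, rfl⟩ := ent_surj p hp.pos f
    rw [← ent_rho, map_pow, h1, hd]
    simp
  · refine ⟨-(rho R p P).charpoly.coeff 0, fun f => ?_⟩
    obtain ⟨v, rfl⟩ := ent_surj p hp.pos f
    rw [← ent_rho, map_pow, h2, hs]

end ModP
section BaseChange

open Polynomial

variable {R R' : Type} [CommRing R] [CommRing R'] [Algebra R R']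

/-- base change -/
def Wmap (R R' : Type) [CommRing R] [CommRing R'] [Algebra R R'] : Weyl R →ₐ[R] Weyl R' :=
  Wlift (Wx R') (Wy R') (W_rel R')

theorem W_smul (r : R) (a : Weyl R') : r • a = algebraMap R R' r • a := by
  rw [algebraMap_smul]

theorem Wmap_mon (u : ℕ × ℕ) : Wmap R R' (mon R u) = mon R' u := by
  simp [Wmap, mon]

theorem Wmap_Φ (c : ℕ × ℕ →₀ R) :
    Wmap R R' (Φ R c) = Φ R' (c.mapRange (algebraMap R R') (map_zero _)) := by
  induction c using Finsupp.induction_linear with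
  | zero => simp
  | add f g hf hg =>
    rw [map_add, map_add, hf, hg, Finsupp.mapRange_add (fun a b => map_add _ a b), map_add]
  | single v c =>
    simp only [Φ, Finsupp.mapRange_single, Finsupp.linearCombination_single, map_smul, Wmap_mon]
    exact W_smul _ _

theorem Wmap_inj [IsDomain R'] [CharZero R'] (hi : Function.Injective (algebraMap R R')) :
    Function.Injective (Wmap R R') := by
  intro a b hab
  obtain ⟨c, rfl⟩ := Φ_surj a
  obtain ⟨d, rfl⟩ := Φ_surj b
  rw [Wmap_Φ, Wmap_Φ] at hab
  have := Finsupp.mapRange_injective _ (map_zero _) hi (Φ_inj hab)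
  rw [this]

theorem Wmap_act (a : Weyl R) : ∀ f : R[X],
    act R' (Wmap R R' a) (f.map (algebraMap R R')) = (act R a f).map (algebraMap R R') := by
  have ha : a ∈ Algebra.adjoin R {Wx R, Wy R} := by rw [W_adjoin]; trivial
  induction ha using Algebra.adjoin_induction with
  | mem x hx =>
    intro f
    rcases hx with rfl | rfl
    · simp [Wmap, act_x]
    · simp [Wmap, act_y, derivative_map]
  | algebraMap c =>
    intro f
    rw [AlgHom.commutes, AlgHom.commutes, Algebra.algebraMap_eq_smul_one, W_smul, map_smul, map_one]
    simp
  | add x y _ _ hx hy =>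
    intro v
    rw [map_add, map_add, map_add, LinearMap.add_apply, hx, hy, LinearMap.add_apply,
      Polynomial.map_add]
  | mul x y _ _ hx hy =>
    intro v
    rw [map_mul, map_mul, map_mul, Module.End.mul_apply, hy, hx]; rfl

theorem Wmap_bet (a : Weyl R) :
    bet R' (Wmap R R' a) = MulOpposite.op (Wmap R R' (bet R a).unop) := by
  have ha : a ∈ Algebra.adjoin R {Wx R, Wy R} := by rw [W_adjoin]; trivial
  induction ha using Algebra.adjoin_induction with
  | mem x hx =>
    rcases hx with rfl | rfl
    · simp [Wmap, bet]
    · simp [Wmap, bet]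
  | algebraMap c =>
    rw [AlgHom.commutes, AlgHom.commutes, Algebra.algebraMap_eq_smul_one, W_smul, map_smul, map_one,
      Algebra.algebraMap_eq_smul_one]
    apply MulOpposite.unop_injective
    simp [Algebra.algebraMap_eq_smul_one]
  | add x y _ _ hx hy =>
    rw [map_add, map_add, map_add, hx, hy]
    simp
  | mul x y _ _ hx hy =>
    rw [map_mul, map_mul, map_mul, hx, hy]
    simp

end BaseChange
section Spread

open Polynomial

theorem int_jacobson : IsJacobsonRing ℤ := by
  rw [isJacobsonRing_iff_prime_eq]
  intro I hI
  by_cases h : I = ⊥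
  · subst h
    rw [eq_bot_iff]
    intro x hx
    rw [Ideal.mem_jacobson_bot] at hx
    have h1 := hx x
    rw [Int.isUnit_iff] at h1
    rw [Ideal.mem_bot]
    rcases h1 with h1 | h1 <;> nlinarith [mul_self_nonneg x]
  · have := hI.isMaximal h
    exact Ideal.jacobson_eq_self_of_isMaximal

theorem sum_range_pred {B : Type} [AddCommMonoid B] (g : ℕ → B) (n : ℕ) (hn : 0 < n) :
    ∑ k ∈ Finset.range n, g k = ∑ k ∈ Finset.range (n-1), g (k+1) + g 0 := by
  obtain ⟨m, rfl⟩ : ∃ m, n = m + 1 := ⟨n - 1, by omega⟩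
  rw [Finset.sum_range_succ']; rfl

theorem exists_field_modp (S : Type) [CommRing S] [Nontrivial S] [Algebra.FiniteType ℤ S] :
    ∃ (F : Type) (_ : Field F) (_ : Algebra S F) (p : ℕ), p.Prime ∧ CharP F p := by
  obtain ⟨m, hm⟩ := Ideal.exists_maximal S
  let : Field (S ⧸ m) := Ideal.Quotient.field m
  refine ⟨S ⧸ m, inferInstance, inferInstance, ?_⟩
  have : Algebra.FiniteType ℤ (S ⧸ m) :=
    Algebra.FiniteType.of_surjective (Ideal.Quotient.mkₐ ℤ m) (Ideal.Quotient.mkₐ_surjective ℤ m)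
  have := int_jacobson
  have hfin : Module.Finite ℤ (S ⧸ m) := finite_of_finite_type_of_isJacobsonRing ℤ (S ⧸ m)
  obtain ⟨p, hp⟩ := CharP.exists (S ⧸ m)
  rcases CharP.char_is_prime_or_zero (S ⧸ m) p with h | h
  · exact ⟨p, h, hp⟩
  · subst h
    have := CharP.charP_to_charZero (S ⧸ m)
    have : Algebra.IsIntegral ℤ (S ⧸ m) := inferInstance
    exact absurd (isField_of_isIntegral_of_isField (R := ℤ) (S := S ⧸ m)
      (FaithfulSMul.algebraMap_injective ℤ _)
      (Field.toIsField _)) Int.not_isField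

variable {S : Type} [CommRing S]

theorem map_quot_eq_zero (p : ℕ) (f : S[X])
    (hf : f.map (algebraMap S (S ⧸ Ideal.span {(p:S)})) = 0) : ∃ g : S[X], f = (p:S) • g := by
  have : C (p:S) ∣ f := by
    rw [C_dvd_iff_dvd_coeff]
    intro i
    have := congrArg (fun f => f.coeff i) hf
    simp only [coeff_map, coeff_zero, Ideal.Quotient.algebraMap_eq, Ideal.Quotient.eq_zero_iff_mem,
      Ideal.mem_span_singleton] at this
    exact this
  obtain ⟨g, hg⟩ := this
  exact ⟨g, by rw [hg, smul_eq_C_mul]⟩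

theorem lift_modp (p : ℕ) [Fact p.Prime] (hp2 : p ≠ 2) (hS : ¬ IsUnit (p : S)) (P Q : Weyl S)
    (h : Q * P = P * Q + 1) (hQ : bet S Q = MulOpposite.op (-Q)) :
    (∀ f, ∃ g : S[X], act S (Q ^ p) f = (p:S) • g) ∧
    ∃ ζ : S[X], ∀ f, ∃ g : S[X], act S (P ^ p) f = expand S p ζ * f + (p:S) • g := by
  have hp : p.Prime := Fact.out
  have : Nontrivial (S ⧸ Ideal.span {(p:S)}) :=
    Ideal.Quotient.nontrivial_iff.mpr (by rwa [Ne, Ideal.span_singleton_eq_top])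
  have : CharP (S ⧸ Ideal.span {(p:S)}) p := by
    rw [CharP.charP_iff_prime_eq_zero hp]
    have : ((p : S) : S ⧸ Ideal.span {(p:S)}) = 0 :=
      Ideal.Quotient.eq_zero_iff_mem.mpr (Ideal.mem_span_singleton_self _)
    simpa using this
  have h1 := modp_main (R := S ⧸ Ideal.span {(p:S)}) p hp2 (Wmap S _ P) (Wmap S _ Q)
    (by rw [← map_mul, h]; simp) (by rw [Wmap_bet, hQ]; simp)
  obtain ⟨h1, ζ, h2⟩ := h1
  obtain ⟨z, hz⟩ := Polynomial.map_surjective (algebraMap S (S ⧸ Ideal.span {(p:S)}))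
    Ideal.Quotient.mk_surjective ζ
  refine ⟨fun f => map_quot_eq_zero p _ ?_, z, fun f => ?_⟩
  · rw [← Wmap_act, map_pow, h1]
  · obtain ⟨g, hg⟩ := map_quot_eq_zero p (act S (P ^ p) f - expand S p z * f) (by
      rw [Polynomial.map_sub, ← Wmap_act, map_pow, h2, Polynomial.map_mul, ← hz,
        Polynomial.map_expand, sub_self])
    exact ⟨g, by rw [← hg]; ring⟩

theorem nonconst [IsDomain S] [CharZero S] (p : ℕ) [Fact p.Prime] {F : Type} [Field F]
    [Algebra S F] [CharP F p] (P Q : Weyl S) (h : Q * P = P * Q + 1)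
    (hq : ∀ f, ∃ g : S[X], act S (Q ^ p) f = (p:S) • g) (ζ : S[X])
    (hz : ∀ f, ∃ g : S[X], act S (P ^ p) f = expand S p ζ * f + (p:S) • g) :
    (ζ.map (algebraMap S F)).natDegree ≠ 0 := by
  intro hdeg
  have hp : p.Prime := Fact.out
  have hpS : (p : S) ≠ 0 := by exact_mod_cast hp.ne_zero
  have hpF : algebraMap S F (p : S) = 0 := by simp
  let π := Polynomial.mapRingHom (algebraMap S F)
  have hsm : ∀ (s : S) (f : S[X]), π (s • f) = algebraMap S F s • π f := by
    intro s f
    rw [smul_eq_C_mul, smul_eq_C_mul, map_mul]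
    simp [π]
  choose A hA using hq
  choose B hB using hz
  set E := expand S p ζ with hE
  have canc : ∀ f g : S[X], (p:S) • f = (p:S) • g → f = g := fun f g hfg =>
    smul_right_injective _ hpS hfg
  have hAs : ∀ (s : S) f, A (s • f) = s • A f := by
    intro s f
    apply canc
    rw [← hA, map_smul, hA, smul_comm]
  have hAa : ∀ f g, A (f + g) = A f + A g := by
    intro f g
    apply canc
    rw [← hA, map_add, hA, hA, smul_add]
  let AL : S[X] →ₗ[S] S[X] := { toFun := A, map_add' := hAa, map_smul' := hAs }
  have hker : ∀ f : S[X], π f = 0 → π (A f) = 0 := by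
    intro f hf
    have h1 : A f = ∑ i ∈ f.support, f.coeff i • A (X ^ i) := by
      change AL f = ∑ i ∈ f.support, f.coeff i • AL (X ^ i)
      conv_lhs => rw [f.as_sum_support_C_mul_X_pow]
      rw [map_sum]
      simp only [← smul_eq_C_mul, map_smul]
    rw [h1, map_sum]
    apply Finset.sum_eq_zero
    intro i _
    have := congrArg (fun f => f.coeff i) hf
    simp only [π, coe_mapRingHom, coeff_map, coeff_zero] at this
    rw [hsm, this, zero_smul]
  -- constant
  set c := ζ.coeff 0
  have hEc : π (E - c • 1) = 0 := by
    have h1 := Polynomial.eq_C_of_natDegree_eq_zero hdeg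
    rw [map_sub, hsm]
    simp only [π, coe_mapRingHom, hE, Polynomial.map_expand]
    rw [h1]
    simp only [expand_C, coeff_map, Polynomial.map_one, smul_eq_C_mul, mul_one, c, sub_self]
  have hAE : π (A E) = algebraMap S F c • π (A 1) := by
    have h1 := hker _ hEc
    have h2 : A E = A (E - c • 1) + c • A 1 := by rw [← hAs, ← hAa]; simp
    rw [h2, map_add, h1, zero_add, hsm]
  have hEE : π E = C (algebraMap S F c) := by
    rw [map_sub, sub_eq_zero, hsm] at hEc
    rw [hEc, map_one, smul_eq_C_mul, mul_one]
  -- the commutator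
  have e1 : act S (Q ^ p) (act S (P ^ p) 1) = (p:S) • (A E + (p:S) • A (B 1)) := by
    rw [hB, mul_one, map_add, map_smul, hA, hA, smul_add]
  have e2 : act S (P ^ p) (act S (Q ^ p) 1) = (p:S) • (E * A 1 + (p:S) • B (A 1)) := by
    rw [hA 1, map_smul, hB]
  have e3 := congrArg (fun a => act S a 1) (normal_order P Q h p p)
  simp only [map_mul, Module.End.mul_apply] at e3
  rw [Finset.sum_range_succ, sum_range_pred _ p hp.pos, map_add, map_add, LinearMap.add_apply,
    LinearMap.add_apply, e1] at e3
  have e4 : nc p p 0 = 1 := by simp [nc]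
  have e5 : nc p p p = p * (p-1).factorial := by
    simp [nc, Nat.mul_factorial_pred hp.ne_zero]
  have e6 : ∃ H : S[X], act S (∑ k ∈ Finset.range (p-1),
      nc p p (k+1) • (P ^ (p - (k+1)) * Q ^ (p - (k+1)))) 1 = (p:S) • (p:S) • H := by
    rw [map_sum, LinearMap.sum_apply]
    have : ∀ k ∈ Finset.range (p-1), ∃ d : ℕ, nc p p (k+1) = p * (p * d) := by
      intro k hk
      rw [Finset.mem_range] at hk
      obtain ⟨d, hd⟩ := hp.dvd_choose_self (k := k+1) (by omega) (by omega)
      exact ⟨(k+1).factorial * d * d, by rw [nc, hd]; ring⟩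
    choose! d hd using this
    refine ⟨∑ k ∈ Finset.range (p-1), (d k : S) • act S (P ^ (p - (k+1)) * Q ^ (p - (k+1))) 1, ?_⟩
    rw [Finset.smul_sum, Finset.smul_sum]
    apply Finset.sum_congr rfl
    intro k hk
    rw [hd k hk, map_nsmul, LinearMap.smul_apply, smul_smul, smul_smul, ← Nat.cast_smul_eq_nsmul S]
    push_cast
    ring_nf
  obtain ⟨H, hH⟩ := e6
  rw [hH, e4, e5] at e3
  simp only [Nat.sub_zero, Nat.sub_self, one_smul, pow_zero, mul_one, map_mul,
    Module.End.mul_apply] at e3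
  have e9 : act S ((p * (p-1).factorial) • (1 : Weyl S)) 1
      = (p:S) • (((p-1).factorial : ℕ) : S) • (1 : S[X]) := by
    rw [map_nsmul, map_one (act S), LinearMap.smul_apply, Module.End.one_apply,
      ← Nat.cast_smul_eq_nsmul S, Nat.cast_mul, mul_smul]
  rw [e2, e9, ← smul_add, ← smul_add] at e3
  have e7 := congrArg π (canc _ _ e3)
  simp only [map_add, hsm, hpF, zero_smul, hAE, add_zero, zero_add, map_mul, hEE, map_one] at e7
  simp only [smul_eq_C_mul, mul_one] at e7
  have e8 : C (algebraMap S F ((p-1).factorial : ℕ)) = 0 := by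
    linear_combination -e7
  rw [C_eq_zero, map_natCast, CharP.cast_eq_zero_iff F p, hp.dvd_factorial] at e8
  have := hp.pos
  omega

end Spread
section Spread2

open Polynomial

theorem comm_pow_two {B : Type} [Ring B] (P Q : B) (h : Q * P = P * Q + 1) (b : ℕ) :
    P * Q ^ b = Q ^ b * P - b • Q ^ (b - 1) := by
  have h1 : (-P) * Q = Q * (-P) + 1 := by
    rw [mul_neg, h, neg_mul]; abel
  have := comm_pow Q (-P) h1 b
  rw [neg_mul, mul_neg] at this
  rw [neg_eq_iff_eq_neg.mp this]; abel

theorem bounded_orbit {F : Type} [Field F] (P Q : Module.End F F[X]) (h : Q * P = P * Q + 1)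
    (p : ℕ) (hq : Q ^ p = 0) (A : ℕ) (hh : ℕ → F[X])
    (hrel : (P ^ A) 1 = ∑ a ∈ Finset.range A, (aeval Q (hh a)) ((P ^ a) 1)) :
    ∃ N, ∀ n, ((P ^ n) 1).natDegree ≤ N := by
  let I := Finset.range A ×ˢ Finset.range p
  let g : ℕ × ℕ → F[X] := fun ab => (Q ^ ab.2) ((P ^ ab.1) 1)
  let V := Submodule.span F (g '' I)
  have hg : ∀ a b, a < A → (Q ^ b) ((P ^ a) 1) ∈ V := by
    intro a b ha
    by_cases hb : b < p
    · exact Submodule.subset_span ⟨(a, b), by simp [I, ha, hb], rfl⟩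
    · have : Q ^ b = 0 := by
        rw [← Nat.sub_add_cancel (not_lt.mp hb), pow_add, hq, mul_zero]
      rw [this]; simp
  have hQ : ∀ v ∈ V, Q v ∈ V := by
    intro v hv
    induction hv using Submodule.span_induction with
    | mem x hx =>
      obtain ⟨⟨a, b⟩, hab, rfl⟩ := hx
      have ha : a < A ∧ b < p := by simpa [I] using hab
      have := hg a (b+1) ha.1
      rwa [pow_succ', Module.End.mul_apply] at this
    | zero => simp
    | add x y _ _ hx hy => rw [map_add]; exact V.add_mem hx hy
    | smul c x _ hx => rw [map_smul]; exact V.smul_mem _ hx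
  have hQb : ∀ b, ∀ v ∈ V, (Q ^ b) v ∈ V := by
    intro b
    induction b with
    | zero => intro v hv; simpa using hv
    | succ b ih => intro v hv; rw [pow_succ', Module.End.mul_apply]; exact hQ _ (ih v hv)
  have hQf : ∀ f : F[X], ∀ v ∈ V, (aeval Q f) v ∈ V := by
    intro f v hv
    rw [aeval_eq_sum_range, LinearMap.sum_apply]
    exact V.sum_mem fun i _ => by
      rw [LinearMap.smul_apply]; exact V.smul_mem _ (hQb _ _ hv)
  have hPle : ∀ a, a ≤ A → (P ^ a) 1 ∈ V := by
    intro a ha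
    rcases ha.lt_or_eq with ha | rfl
    · simpa using hg a 0 ha
    · rw [hrel]
      exact V.sum_mem fun i hi => hQf _ _ (by simpa using hg i 0 (by simpa using hi))
  have hcom : ∀ b, P * Q ^ b = Q ^ b * P - b • Q ^ (b - 1) := by
    intro b
    exact comm_pow_two P Q h b
  have hP : ∀ v ∈ V, P v ∈ V := by
    intro v hv
    induction hv using Submodule.span_induction with
    | mem x hx =>
      obtain ⟨⟨a, b⟩, hab, rfl⟩ := hx
      have ha : a < A ∧ b < p := by simpa [I] using hab
      change (P * Q ^ b) ((P ^ a) 1) ∈ V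
      rw [hcom, LinearMap.sub_apply, Module.End.mul_apply, ← Module.End.mul_apply P, ← pow_succ',
        LinearMap.smul_apply]
      exact V.sub_mem (hQb _ _ (hPle _ ha.1)) (nsmul_mem (hg _ _ ha.1) _)
    | zero => simp
    | add x y _ _ hx hy => rw [map_add]; exact V.add_mem hx hy
    | smul c x _ hx => rw [map_smul]; exact V.smul_mem _ hx
  have hPn : ∀ n, (P ^ n) 1 ∈ V := by
    intro n
    induction n with
    | zero => exact hPle 0 (Nat.zero_le _)
    | succ n ih => rw [pow_succ', Module.End.mul_apply]; exact hP _ ih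
  refine ⟨I.sup fun ab => (g ab).natDegree, fun n => ?_⟩
  have hV : V ≤ degreeLE F ((I.sup fun ab => (g ab).natDegree : ℕ) : WithBot ℕ) := by
    apply Submodule.span_le.mpr
    rintro _ ⟨ab, hab, rfl⟩
    rw [SetLike.mem_coe, mem_degreeLE]
    refine degree_le_natDegree.trans ?_
    exact_mod_cast Finset.le_sup (f := fun ab => (g ab).natDegree) hab
  exact natDegree_le_iff_degree_le.mpr (mem_degreeLE.mp (hV (hPn n)))

theorem spread_false (S : Type) [CommRing S] [IsDomain S] [CharZero S] [Algebra.FiniteType ℤ S]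
    (h2 : IsUnit (2:S)) (P Q : Weyl S) (h : Q * P = P * Q + 1)
    (hQ : bet S Q = MulOpposite.op (-Q)) (A : ℕ) (hh : ℕ → S[X])
    (hrel : act S (P ^ A) 1 = ∑ a ∈ Finset.range A, act S (aeval Q (hh a) * P ^ a) 1) : False := by
  obtain ⟨F, _, _, p, hp, _⟩ := exists_field_modp S
  have : Fact p.Prime := ⟨hp⟩
  have hpF : algebraMap S F (p : S) = 0 := by simp
  have hp2 : p ≠ 2 := by
    rintro rfl
    have := h2.map (algebraMap S F)
    rw [show (2:S) = ((2:ℕ) : S) by norm_num, hpF] at this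
    exact not_isUnit_zero this
  have hu : ¬ IsUnit (p : S) := by
    intro hu
    have := hu.map (algebraMap S F)
    rw [hpF] at this
    exact not_isUnit_zero this
  obtain ⟨h3, ζ, h4⟩ := lift_modp p hp2 hu P Q h hQ
  have h5 := nonconst (F := F) p P Q h h3 ζ h4
  have hsm : ∀ f : S[X], ((p:S) • f).map (algebraMap S F) = 0 := by
    intro f
    rw [smul_eq_C_mul, Polynomial.map_mul, map_C, hpF, C_0, zero_mul]
  have hq0 : (act F (Wmap S F Q)) ^ p = 0 := by
    apply Polynomial.lhom_ext'
    intro n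
    apply LinearMap.ext_ring
    rw [← map_pow, ← map_pow]
    have h6 := Wmap_act (R' := F) (Q ^ p) (X ^ n)
    obtain ⟨g, hg⟩ := h3 (X ^ n)
    rw [hg, hsm] at h6
    simpa [X_pow_eq_monomial] using h6
  have hae : ∀ (f : S[X]), Wmap S F (aeval Q f) = aeval (Wmap S F Q) (f.map (algebraMap S F)) := by
    intro f
    rw [← Polynomial.aeval_algHom_apply, Polynomial.aeval_map_algebraMap]
  obtain ⟨N, hN⟩ := bounded_orbit (act F (Wmap S F P)) (act F (Wmap S F Q))
    (by rw [← map_mul, ← map_mul, h]; simp) p hq0 A (fun a => (hh a).map (algebraMap S F)) (by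
      have h6 := congrArg (Polynomial.map (algebraMap S F)) hrel
      rw [← Wmap_act, Polynomial.map_sum, Polynomial.map_one, map_pow, map_pow] at h6
      rw [h6]
      apply Finset.sum_congr rfl
      intro a _
      rw [← Wmap_act, Polynomial.map_one, map_mul, map_mul, Module.End.mul_apply, map_pow, map_pow,
        hae, ← Polynomial.aeval_algHom_apply])
  have hpow : ∀ n, ((act F (Wmap S F P)) ^ (p * n)) 1
      = (expand F p (ζ.map (algebraMap S F))) ^ n := by
    intro n
    induction n with
    | zero => simp
    | succ n ih =>
      have e : expand F p (ζ.map (algebraMap S F)) = (expand S p ζ).map (algebraMap S F) := by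
        rw [Polynomial.map_expand]
      rw [mul_add, mul_one, add_comm, pow_add, Module.End.mul_apply, ih, e, ← Polynomial.map_pow,
        ← map_pow, ← map_pow, Wmap_act]
      obtain ⟨g, hg⟩ := h4 (expand S p ζ ^ n)
      rw [hg, Polynomial.map_add, hsm, add_zero, pow_succ', Polynomial.map_mul, Polynomial.map_pow]
  have h7 := hN (p * (N+1))
  rw [hpow, natDegree_pow, natDegree_expand] at h7
  have : 1 ≤ (ζ.map (algebraMap S F)).natDegree * p :=
    Nat.mul_pos (Nat.pos_of_ne_zero h5) hp.pos
  nlinarith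

end Spread2
section Finiteness

open Polynomial

variable {K : Type} [Field K]

theorem fin_rel (P T : Module.End K K[X]) (d n0 : ℕ) (hd : 1 ≤ d)
    (hT : ∀ n, n0 ≤ n → (T (X ^ n)).natDegree = n + d) :
    ∃ (A : ℕ) (hh : ℕ → K[X]), (P ^ A) 1 = ∑ a ∈ Finset.range A, (aeval T (hh a)) ((P ^ a) 1) := by
  let o := Module.AEval'.of T
  have ho : ∀ (f : K[X]) (m : K[X]), o (aeval T f m) = f • o m := fun f m =>
    Module.AEval.of_aeval_smul T f m
  have hoC : ∀ (c : K) (m : K[X]), o (c • m) = (C c : K[X]) • o m := by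
    intro c m
    rw [← ho]
    simp [Module.algebraMap_end_apply]
  let N : Submodule K[X] (Module.AEval' T) :=
    Submodule.span K[X] ((fun k : ℕ => o (X ^ k)) '' (Finset.range (n0 + d)))
  have hN : ∀ n, o (X ^ n) ∈ N := by
    intro n
    induction n using Nat.strong_induction_on with
    | _ n ih =>
    by_cases hn : n < n0 + d
    · exact Submodule.subset_span ⟨n, by simpa using hn, rfl⟩
    · have h1 := hT (n - d) (by omega)
      rw [show n - d + d = n by omega] at h1
      have h2 : o (T (X ^ (n - d))) ∈ N := by
        have := N.smul_mem X (ih (n - d) (by omega))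
        rwa [← ho, aeval_X] at this
      have h3 : (T (X ^ (n - d))).coeff n ≠ 0 := by
        have h0 : T (X ^ (n - d)) ≠ 0 := by
          intro h0; rw [h0, natDegree_zero] at h1; omega
        have := leadingCoeff_ne_zero.mpr h0
        rwa [leadingCoeff, h1] at this
      rw [(T (X ^ (n - d))).as_sum_range_C_mul_X_pow, h1, Finset.sum_range_succ, map_add,
        map_sum] at h2
      simp only [← smul_eq_C_mul, hoC] at h2
      have h4 := (N.add_mem_iff_right (N.sum_mem fun i hi => N.smul_mem _
        (ih i (by simpa using hi)))).mp h2
      have h5 := N.smul_mem (C ((T (X ^ (n - d))).coeff n)⁻¹) h4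
      rwa [smul_smul, ← C_mul, inv_mul_cancel₀ h3, C_1, one_smul] at h5
  have htop : N = ⊤ := by
    rw [eq_top_iff]
    intro x _
    obtain ⟨f, rfl⟩ := o.surjective x
    rw [f.as_sum_support_C_mul_X_pow, map_sum]
    refine N.sum_mem fun i _ => ?_
    rw [← smul_eq_C_mul, hoC]
    exact N.smul_mem _ (hN i)
  have hfin : Module.Finite K[X] (Module.AEval' T) := by
    rw [Module.finite_def, ← htop]
    exact Submodule.fg_span (Set.toFinite _)
  have hnoeth : IsNoetherian K[X] (Module.AEval' T) := inferInstance
  let v : ℕ → Module.AEval' T := fun a => o ((P ^ a) 1)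
  obtain ⟨A, hA⟩ := monotone_stabilizes_iff_noetherian.mpr hnoeth
    ⟨fun A => Submodule.span K[X] (v '' (Finset.range A)), fun a b hab =>
      Submodule.span_mono (Set.image_mono (by simpa using hab))⟩
  have h1 : v A ∈ Submodule.span K[X] (v '' (Finset.range A)) := by
    have h2 : Submodule.span K[X] (v '' (Finset.range A))
        = Submodule.span K[X] (v '' (Finset.range (A+1))) := hA (A+1) (by omega)
    rw [h2]
    exact Submodule.subset_span ⟨A, by simp, rfl⟩
  rw [Submodule.mem_span_image_finset_iff_exists_fun] at h1
  obtain ⟨hh, hhh⟩ := h1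
  refine ⟨A, fun a => if h : a ∈ Finset.range A then hh ⟨a, h⟩ else 0, ?_⟩
  apply o.injective
  rw [map_sum]
  simp only [ho]
  rw [← Finset.sum_coe_sort]
  refine hhh.symm.trans (Finset.sum_congr rfl fun a _ => ?_)
  rw [dif_pos a.2]

theorem lead_deg [CharZero K] (c : ℕ × ℕ →₀ K) (d : ℕ) (u0 : ℕ × ℕ) (hu0 : u0 ∈ c.support)
    (hd0 : u0.1 = u0.2 + d) (hd1 : 1 ≤ d) (hmax : ∀ u ∈ c.support, u.1 ≤ u.2 + d) :
    ∃ n0, ∀ n, n0 ≤ n → (act K (Φ K c) (X ^ n)).natDegree = n + d := by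
  classical
  let s := c.support.filter (fun u => u.1 = u.2 + d)
  let q : K[X] := ∑ u ∈ s, C (c u) * descPochhammer K u.2
  have hqe : ∀ n : ℕ, q.eval (n:K) = ∑ u ∈ s, c u * (n.descFactorial u.2 : K) := by
    intro n
    simp [q, eval_finsetSum, descPochhammer_eval_eq_descFactorial]
  have hq : q ≠ 0 := by
    obtain ⟨w, hw, hmin⟩ := Finset.exists_min_image s (fun u => u.2)
      ⟨u0, by simpa [s, hd0] using hu0⟩
    intro h0
    have h1 := hqe w.2
    rw [h0, eval_zero, Finset.sum_eq_single w] at h1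
    · have hw1 : c w ≠ 0 := by
        have := (Finset.mem_filter.mp hw).1
        simpa using this
      have : ((w.2.descFactorial w.2 : ℕ) : K) ≠ 0 := by
        rw [Nat.descFactorial_self]; exact_mod_cast Nat.factorial_ne_zero _
      exact mul_ne_zero hw1 this h1.symm
    · intro u hu hne
      have h2 := hmin u hu
      have h3 : w.2 < u.2 := by
        rcases h2.lt_or_eq with h | h
        · exact h
        · exfalso
          apply hne
          have a1 := (Finset.mem_filter.mp hw).2
          have a2 := (Finset.mem_filter.mp hu).2
          ext <;> omega
      rw [Nat.descFactorial_eq_zero_iff_lt.mpr h3]; simp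
    · intro h; exact absurd hw h
  obtain ⟨n1, hn1⟩ : ∃ n1 : ℕ, ∀ n, n1 ≤ n → q.eval (n:K) ≠ 0 := by
    have hfin : {n : ℕ | q.eval (n:K) = 0}.Finite := by
      have h1 : (q.roots.toFinset : Set K).Finite := Finset.finite_toSet _
      refine Set.Finite.subset (h1.preimage (f := fun n : ℕ => (n:K))
        (Nat.cast_injective.injOn)) ?_
      intro n hn
      simp [hq] at hn ⊢
      exact hn
    obtain ⟨M, hM⟩ := hfin.bddAbove
    exact ⟨M+1, fun n hn h => by have := hM h; omega⟩
  refine ⟨n1 + c.support.sup (fun u => u.2), fun n hn => ?_⟩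
  have hcoe : ∀ k, (act K (Φ K c) (X ^ n)).coeff k
      = ∑ u ∈ c.support, c u * (n.descFactorial u.2 * if k = u.1 + (n - u.2) then 1 else 0) := by
    intro k
    simp only [act_Φ, Finsupp.sum, Polynomial.finsetSum_coeff, Polynomial.coeff_smul, act_mon_X,
      Polynomial.coeff_C_mul, Polynomial.coeff_X_pow, smul_eq_mul]
  have hle : ∀ u ∈ c.support, u.2 ≤ n := by
    intro u hu
    have := Finset.le_sup (f := fun u : ℕ × ℕ => u.2) hu
    omega
  apply natDegree_eq_of_le_of_coeff_ne_zero
  · rw [natDegree_le_iff_coeff_eq_zero]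
    intro k hk
    rw [hcoe]
    apply Finset.sum_eq_zero
    intro u hu
    have := hle u hu
    have := hmax u hu
    rw [if_neg (by omega)]; simp
  · have h2 := hn1 n (by omega)
    rw [hqe] at h2
    rw [hcoe]
    convert h2 using 1
    rw [Finset.sum_filter]
    apply Finset.sum_congr rfl
    intro u hu
    have := hle u hu
    have := hmax u hu
    by_cases h : u.1 = u.2 + d
    · rw [if_pos (by omega), if_pos h]; simp
    · rw [if_neg (by omega), if_neg h]; simp

theorem lift_fs {ι : Type} (S : Subalgebra ℤ K) (c : ι →₀ K) (h : ∀ i ∈ c.support, c i ∈ S) :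
    ∃ c' : ι →₀ S, c'.mapRange (algebraMap S K) (map_zero _) = c := by
  have h' : ∀ i, c i ∈ S := by
    intro i
    by_cases hi : i ∈ c.support
    · exact h i hi
    · rw [Finsupp.notMem_support_iff.mp hi]; exact S.zero_mem
  refine ⟨Finsupp.onFinset c.support (fun i => ⟨c i, h' i⟩) ?_, ?_⟩
  · intro i hi
    rw [Finsupp.mem_support_iff]
    intro h0
    exact hi (Subtype.ext h0)
  · ext i; simp

theorem lift_poly (S : Subalgebra ℤ K) (f : K[X]) (h : ∀ i ∈ f.support, f.coeff i ∈ S) :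
    ∃ f' : S[X], f'.map (algebraMap S K) = f := by
  have : f ∈ Polynomial.lifts (algebraMap S K) := by
    rw [Polynomial.lifts_iff_coeff_lifts]
    intro i
    by_cases hi : i ∈ f.support
    · exact ⟨⟨_, h i hi⟩, rfl⟩
    · rw [notMem_support_iff.mp hi]; exact ⟨0, by simp⟩
  rwa [Polynomial.mem_lifts] at this

theorem support_le [CharZero K] (P : Weyl K) (c : ℕ × ℕ →₀ K) (h : Φ K c * P = P * Φ K c + 1)
    (hQ : bet K (Φ K c) = MulOpposite.op (-Φ K c)) : ∀ u ∈ c.support, u.1 ≤ u.2 := by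
  classical
  by_contra! hcon
  obtain ⟨u1, hu1, hlt⟩ := hcon
  obtain ⟨u0, hu0, hmax⟩ := Finset.exists_max_image c.support (fun u => (u.1:ℤ) - u.2) ⟨u1, hu1⟩
  have h1 := hmax u1 hu1
  obtain ⟨n0, hn0⟩ := lead_deg c (u0.1 - u0.2) u0 hu0 (by omega) (by omega) (fun u hu => by
    have := hmax u hu; omega)
  obtain ⟨A, hh, hrel⟩ := fin_rel (act K P) (act K (Φ K c)) _ n0 (by omega) hn0
  obtain ⟨e, rfl⟩ := Φ_surj P
  let E : Finset K := insert (2⁻¹ : K) (c.support.image c ∪ e.support.image e ∪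
    (Finset.range A).biUnion fun a => (hh a).support.image (hh a).coeff)
  let S : Subalgebra ℤ K := Algebra.adjoin ℤ (E : Set K)
  have hES : ∀ x ∈ E, x ∈ S := fun x hx => Algebra.subset_adjoin hx
  have hft : Algebra.FiniteType ℤ S := (Subalgebra.fg_iff_finiteType S).mp ⟨E, rfl⟩
  obtain ⟨c', hc'⟩ := lift_fs S c (fun i hi => hES _ (by
    simp only [E, Finset.mem_insert, Finset.mem_union, Finset.mem_image]
    exact Or.inr (Or.inl (Or.inl ⟨i, hi, rfl⟩))))
  obtain ⟨e', he'⟩ := lift_fs S e (fun i hi => hES _ (by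
    simp only [E, Finset.mem_insert, Finset.mem_union, Finset.mem_image]
    exact Or.inr (Or.inl (Or.inr ⟨i, hi, rfl⟩))))
  have hhl : ∀ a ∈ Finset.range A, ∃ f' : S[X], f'.map (algebraMap S K) = hh a := by
    intro a ha
    refine lift_poly S _ (fun i hi => hES _ ?_)
    simp only [E, Finset.mem_insert, Finset.mem_union, Finset.mem_image, Finset.mem_biUnion]
    exact Or.inr (Or.inr ⟨a, ha, i, hi, rfl⟩)
  choose! h' hh' using hhl
  have hinj : Function.Injective (algebraMap S K) := Subtype.val_injective
  have hWi := Wmap_inj (R := S) (R' := K) hinj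
  have hcW : Wmap S K (Φ S c') = Φ K c := by rw [Wmap_Φ, hc']
  have heW : Wmap S K (Φ S e') = Φ K e := by rw [Wmap_Φ, he']
  have hae : ∀ (f : S[X]), Wmap S K (aeval (Φ S c') f) = aeval (Φ K c) (f.map (algebraMap S K)) := by
    intro f
    rw [← Polynomial.aeval_algHom_apply, Polynomial.aeval_map_algebraMap, hcW]
  have hz : CharZero S := inferInstance
  refine spread_false S ?_ (Φ S e') (Φ S c') ?_ ?_ A h' ?_
  · refine IsUnit.of_mul_eq_one ⟨2⁻¹, hES _ (by simp [E])⟩ ?_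
    apply hinj
    rw [map_mul, map_one]
    change (algebraMap S K) 2 * 2⁻¹ = 1
    rw [map_ofNat]
    exact mul_inv_cancel₀ two_ne_zero
  · apply hWi
    rw [map_mul, map_add, map_mul, map_one, hcW, heW, h]
  · apply MulOpposite.unop_injective
    apply hWi
    have := Wmap_bet (R' := K) (Φ S c')
    rw [hcW, hQ] at this
    have h3 := congrArg MulOpposite.unop this
    simp only [MulOpposite.unop_op] at h3 ⊢
    rw [← h3, map_neg, hcW]
  · apply Polynomial.map_injective _ hinj
    rw [← Wmap_act, Polynomial.map_sum, Polynomial.map_one, map_pow, map_pow, heW, hrel]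
    apply Finset.sum_congr rfl
    intro a ha
    rw [← Wmap_act, Polynomial.map_one, map_mul, map_mul, Module.End.mul_apply, map_pow, map_pow,
        hae, ← Polynomial.aeval_algHom_apply, hh' a ha, heW]

end Finiteness
section Corner

variable {K : Type} [Field K] [CharZero K]

/-- coefficients in the monomial basis -/
def kap (K : Type) [Field K] [CharZero K] : Weyl K ≃ₗ[K] (ℕ × ℕ →₀ K) :=
  (LinearEquiv.ofBijective (Φ K) ⟨Φ_inj, Φ_surj⟩).symm

theorem kap_Φ (c : ℕ × ℕ →₀ K) : kap K (Φ K c) = c :=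
  (LinearEquiv.ofBijective (Φ K) ⟨Φ_inj, Φ_surj⟩).symm_apply_apply c

theorem Φ_kap (a : Weyl K) : Φ K (kap K a) = a :=
  (LinearEquiv.ofBijective (Φ K) ⟨Φ_inj, Φ_surj⟩).apply_symm_apply a

theorem kap_mon (u : ℕ × ℕ) : kap K (mon K u) = Finsupp.single u 1 := by
  rw [← kap_Φ (K := K) (Finsupp.single u 1)]
  simp [Φ]

theorem kap_nsmul (n : ℕ) (u t : ℕ × ℕ) :
    kap K (n • mon K u) t = (n : K) * Finsupp.single u (1 : K) t := by
  rw [map_nsmul (kap K), kap_mon, Finsupp.smul_apply, nsmul_eq_mul]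

theorem mmc_eq (t u v : ℕ × ℕ) (n : ℕ) (h1 : t.1 + n = u.1 + v.1) (h2 : t.2 + n = u.2 + v.2) :
    kap K (mon K u * mon K v) t = (nc u.2 v.1 n : K) := by
  rw [mon_mul, map_sum, Finsupp.finsetSum_apply]
  simp only [kap_nsmul]
  have hz : ∀ m, ¬ (m ≤ u.2 ∧ m ≤ v.1) → nc u.2 v.1 m = 0 := by
    intro m hm
    unfold nc
    by_cases h : m ≤ u.2
    · rw [Nat.choose_eq_zero_of_lt (n := v.1) (by omega)]; simp
    · rw [Nat.choose_eq_zero_of_lt (n := u.2) (by omega)]; simp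
  rw [Finset.sum_eq_single n]
  · by_cases hn : n ≤ u.2 ∧ n ≤ v.1
    · rw [show (u.1 + v.1 - n, u.2 + v.2 - n) = t by ext <;> simp <;> omega]
      simp
    · rw [hz n hn]; simp
  · intro m _ hne
    by_cases hm : m ≤ u.2 ∧ m ≤ v.1
    · rw [Finsupp.single_apply, if_neg]
      · simp
      · intro h
        apply hne
        have := congrArg Prod.fst h
        simp only at this
        omega
    · rw [hz m hm]; simp
  · intro hn
    rw [hz n (by simp at hn; omega)]; simp

theorem mmc_ne (t u v : ℕ × ℕ) (h : kap K (mon K u * mon K v) t ≠ 0) :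
    ∃ n, t.1 + n = u.1 + v.1 ∧ t.2 + n = u.2 + v.2 := by
  by_contra! hcon
  apply h
  rw [mon_mul, map_sum, Finsupp.finsetSum_apply]
  simp only [kap_nsmul]
  apply Finset.sum_eq_zero
  intro m hm
  by_cases hv : m ≤ v.1
  · rw [Finsupp.single_apply, if_neg]
    · simp
    · intro h
      have h1 := congrArg Prod.fst h
      have h2 := congrArg Prod.snd h
      simp only at h1 h2
      simp at hm
      exact hcon m (by omega) (by omega)
  · unfold nc
    rw [Nat.choose_eq_zero_of_lt (n := v.1) (by omega)]; simp

/-- coefficient of the commutator of monomials -/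
def bkt (K : Type) [Field K] [CharZero K] (t u v : ℕ × ℕ) : K :=
  kap K (mon K u * mon K v) t - kap K (mon K v * mon K u) t

theorem bkt_one (t u v : ℕ × ℕ) (h1 : t.1 + 1 = u.1 + v.1) (h2 : t.2 + 1 = u.2 + v.2) :
    bkt K t u v = (u.2 : K) * v.1 - v.2 * u.1 := by
  unfold bkt
  rw [mmc_eq t u v 1 h1 h2, mmc_eq t v u 1 (by omega) (by omega)]
  simp [nc]

theorem bkt_ne (t u v : ℕ × ℕ) (h : bkt K t u v ≠ 0) :
    ∃ n, 1 ≤ n ∧ t.1 + n = u.1 + v.1 ∧ t.2 + n = u.2 + v.2 := by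
  have h0 : ∃ n, t.1 + n = u.1 + v.1 ∧ t.2 + n = u.2 + v.2 := by
    by_cases h1 : kap K (mon K u * mon K v) t = 0
    · obtain ⟨n, hn⟩ := mmc_ne (K := K) t v u (by
        intro h2; apply h; unfold bkt; rw [h1, h2, sub_zero])
      exact ⟨n, by omega⟩
    · exact mmc_ne t u v h1
  obtain ⟨n, hn1, hn2⟩ := h0
  refine ⟨n, ?_, hn1, hn2⟩
  by_contra hlt
  apply h
  unfold bkt
  obtain rfl : n = 0 := by omega
  rw [mmc_eq t u v 0 hn1 hn2, mmc_eq t v u 0 (by omega) (by omega)]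
  simp [nc]

theorem kap_comm (c e : ℕ × ℕ →₀ K) (t : ℕ × ℕ) :
    kap K (Φ K c * Φ K e) t - kap K (Φ K e * Φ K c) t
      = ∑ u ∈ c.support, ∑ v ∈ e.support, c u * e v * bkt K t u v := by
  have h1 : ∀ c e : ℕ × ℕ →₀ K, kap K (Φ K c * Φ K e) t =
      ∑ u ∈ c.support, ∑ v ∈ e.support, c u * e v * kap K (mon K u * mon K v) t := by
    intro c e
    simp only [Φ, Finsupp.linearCombination_apply, Finsupp.sum]
    rw [Finset.sum_mul, map_sum, Finsupp.finsetSum_apply]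
    apply Finset.sum_congr rfl
    intro u _
    rw [Finset.mul_sum, map_sum, Finsupp.finsetSum_apply]
    apply Finset.sum_congr rfl
    intro v _
    rw [smul_mul_smul_comm, map_smul, Finsupp.smul_apply, smul_eq_mul]
  rw [h1 c e, h1 e c, Finset.sum_comm (s := e.support), ← Finset.sum_sub_distrib]
  apply Finset.sum_congr rfl
  intro u _
  rw [← Finset.sum_sub_distrib]
  apply Finset.sum_congr rfl
  intro v _
  unfold bkt
  ring

theorem corner (c e : ℕ × ℕ →₀ K) (h : Φ K c * Φ K e = Φ K e * Φ K c + 1) (s : ℝ) (hs : -1 < s)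
    (C A : ℕ × ℕ) (hC : C ∈ c.support) (hA : A ∈ e.support)
    (hCm : ∀ u ∈ c.support, u ≠ C → (u.1 : ℝ) + s * u.2 < C.1 + s * C.2)
    (hAm : ∀ u ∈ e.support, u ≠ A → (u.1 : ℝ) + s * u.2 < A.1 + s * A.2) :
    C.2 * A.1 = A.2 * C.1 ∨ (A.1 + C.1 = 1 ∧ A.2 + C.2 = 1) := by
  by_contra! hcon
  obtain ⟨hne, h11⟩ := hcon
  have hp1 : 1 ≤ C.1 + A.1 := by
    by_contra hlt
    apply hne
    rw [show C.1 = 0 by omega, show A.1 = 0 by omega]; simp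
  have hp2 : 1 ≤ C.2 + A.2 := by
    by_contra hlt
    apply hne
    rw [show C.2 = 0 by omega, show A.2 = 0 by omega]; simp
  let t : ℕ × ℕ := (C.1 + A.1 - 1, C.2 + A.2 - 1)
  have ht1 : t.1 + 1 = C.1 + A.1 := by simp only [t]; omega
  have ht2 : t.2 + 1 = C.2 + A.2 := by simp only [t]; omega
  have hle : ∀ u ∈ c.support, (u.1 : ℝ) + s * u.2 ≤ C.1 + s * C.2 := by
    intro u hu
    by_cases h : u = C
    · rw [h]
    · exact (hCm u hu h).le
  have hleA : ∀ u ∈ e.support, (u.1 : ℝ) + s * u.2 ≤ A.1 + s * A.2 := by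
    intro u hu
    by_cases h : u = A
    · rw [h]
    · exact (hAm u hu h).le
  have hzero : ∀ u ∈ c.support, ∀ v ∈ e.support, (u ≠ C ∨ v ≠ A) → bkt K t u v = 0 := by
    intro u hu v hv huv
    by_contra hb
    obtain ⟨n, hn, h1, h2⟩ := bkt_ne t u v hb
    have hlt : ((u.1 : ℝ) + s * u.2) + (v.1 + s * v.2) < (C.1 + s * C.2) + (A.1 + s * A.2) := by
      rcases huv with huv | huv
      · exact add_lt_add_of_lt_of_le (hCm u hu huv) (hleA v hv)
      · exact add_lt_add_of_le_of_lt (hle u hu) (hAm v hv huv)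
    have c1 : (t.1 : ℝ) + n = u.1 + v.1 := by exact_mod_cast h1
    have c2 : (t.2 : ℝ) + n = u.2 + v.2 := by exact_mod_cast h2
    have c3 : (t.1 : ℝ) + 1 = C.1 + A.1 := by exact_mod_cast ht1
    have c4 : (t.2 : ℝ) + 1 = C.2 + A.2 := by exact_mod_cast ht2
    have c5 : (1 : ℝ) ≤ n := by exact_mod_cast hn
    have e1 : ((u.1 : ℝ) + s * u.2) + (v.1 + s * v.2) = (t.1 + n) + s * (t.2 + n) := by
      rw [c1, c2]; ring
    have e2 : ((C.1 : ℝ) + s * C.2) + (A.1 + s * A.2) = (t.1 + 1) + s * (t.2 + 1) := by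
      rw [c3, c4]; ring
    rw [e1, e2] at hlt
    nlinarith [mul_nonneg (sub_nonneg.mpr c5) (by linarith : (0:ℝ) ≤ 1 + s)]
  have hk := kap_comm c e t
  rw [h, map_add, Finsupp.add_apply, add_sub_cancel_left, Finset.sum_eq_single C, Finset.sum_eq_single A,
    bkt_one t C A ht1 ht2] at hk
  · have hk1 : kap K (1 : Weyl K) t = 0 := by
      rw [show (1 : Weyl K) = mon K (0,0) by simp [mon], kap_mon, Finsupp.single_apply, if_neg]
      intro h0
      have a1 := congrArg Prod.fst h0
      have a2 := congrArg Prod.snd h0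
      simp only at a1 a2
      omega
    rw [hk1] at hk
    have hd : (C.2 : K) * A.1 - A.2 * C.1 ≠ 0 := by
      rw [sub_ne_zero]; exact_mod_cast hne
    exact mul_ne_zero (mul_ne_zero (Finsupp.mem_support_iff.mp hC) (Finsupp.mem_support_iff.mp hA)) hd
      hk.symm
  · intro v hv hvA
    rw [hzero C hC v hv (Or.inr hvA), mul_zero]
  · intro hh; exact absurd hA hh
  · intro u hu huC
    apply Finset.sum_eq_zero
    intro v hv
    rw [hzero u hu v hv (Or.inl huC), mul_zero]
  · intro hh; exact absurd hC hh

/-- maximal point for an irrational weight -/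
theorem exists_top (s : ℝ) (hs : Irrational s) (S : Finset (ℕ × ℕ)) (hS : S.Nonempty) :
    ∃ C ∈ S, ∀ u ∈ S, u ≠ C → (u.1 : ℝ) + s * u.2 < C.1 + s * C.2 := by
  obtain ⟨C, hC, hm⟩ := Finset.exists_max_image S (fun u => (u.1 : ℝ) + s * u.2) hS
  refine ⟨C, hC, fun u hu hne => lt_of_le_of_ne (hm u hu) ?_⟩
  intro heq
  apply hne
  have h2 : u.2 = C.2 := by
    by_contra h2
    have h3 : ((C.2 : ℝ) - u.2) ≠ 0 := by
      rw [sub_ne_zero]; exact_mod_cast (Ne.symm h2)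
    apply hs
    refine ⟨((u.1 : ℚ) - C.1) / (C.2 - u.2), ?_⟩
    push_cast
    rw [div_eq_iff h3]
    linarith
  have h1 : u.1 = C.1 := by
    rw [h2] at heq
    exact_mod_cast add_right_cancel heq
  exact Prod.ext h1 h2

end Corner
section Newton

set_option maxHeartbeats 2000000 in
theorem newton (U T : Finset (ℕ × ℕ)) (hT0 : (0,0) ∉ T)
    (hT : ∀ u ∈ T, u.1 ≤ u.2) (hTne : T.Nonempty) (A0 : ℕ × ℕ) (hA0 : A0 ∈ U) (hA0' : A0.2 < A0.1)
    (hcor : ∀ s : ℝ, -1 < s → ∀ C ∈ T, ∀ A ∈ U,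
      (∀ u ∈ T, u ≠ C → (u.1 : ℝ) + s * u.2 < C.1 + s * C.2) →
      (∀ u ∈ U, u ≠ A → (u.1 : ℝ) + s * u.2 < A.1 + s * A.2) →
      C.2 * A.1 = A.2 * C.1 ∨ (A.1 + C.1 = 1 ∧ A.2 + C.2 = 1)) :
    ∀ u ∈ T, u = (0,1) := by
  have hUne : U.Nonempty := ⟨A0, hA0⟩
  have hcor2 : ∀ s : ℝ, -1 < s → Irrational s → ∃ C ∈ T, ∃ A ∈ U,
      (∀ u ∈ T, (u.1 : ℝ) + s * u.2 ≤ C.1 + s * C.2) ∧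
      (∀ u ∈ U, (u.1 : ℝ) + s * u.2 ≤ A.1 + s * A.2) ∧
      (C.2 * A.1 = A.2 * C.1 ∨ (A.1 + C.1 = 1 ∧ A.2 + C.2 = 1)) := by
    intro s hs hirr
    obtain ⟨C, hC, hCm⟩ := exists_top s hirr T hTne
    obtain ⟨A, hA, hAm⟩ := exists_top s hirr U hUne
    refine ⟨C, hC, A, hA, ?_, ?_, hcor s hs C hC A hA hCm hAm⟩
    · intro u hu
      by_cases h : u = C
      · rw [h]
      · exact (hCm u hu h).le
    · intro u hu
      by_cases h : u = A
      · rw [h]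
      · exact (hAm u hu h).le
  obtain ⟨D, hD1, hDU, hDT⟩ : ∃ D : ℝ, 0 ≤ D ∧ (∀ u ∈ U, (u.2 : ℝ) ≤ D) ∧ (∀ u ∈ T, (u.2 : ℝ) ≤ D) := by
    refine ⟨((U ∪ T).sup (fun u => u.2) : ℕ), by positivity, ?_, ?_⟩
    · intro u hu
      exact_mod_cast Finset.le_sup (f := fun u : ℕ × ℕ => u.2) (Finset.mem_union_left T hu)
    · intro u hu
      exact_mod_cast Finset.le_sup (f := fun u : ℕ × ℕ => u.2) (Finset.mem_union_right U hu)
  have hD2 : (0:ℝ) < 1 / (D+1) := by positivity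
  have hD3 : 1 / (D+1) * D < 1 := by
    rw [div_mul_eq_mul_div, div_lt_one (by linarith)]; linarith
  have hD4 : 1 / (D+1) ≤ 1 := by
    rw [div_le_one (by linarith)]; linarith
  have hTpos : ∀ u ∈ T, 1 ≤ u.2 := by
    intro u hu
    by_contra h
    have h1 := hT u hu
    apply hT0
    have : u = (0,0) := by ext <;> simp <;> omega
    rwa [← this]
  -- step 1
  obtain ⟨h10, hT1⟩ : (1,0) ∈ U ∧ ∀ u ∈ T, 1 ≤ u.1 → u.1 + 1 < u.2 := by
    obtain ⟨s, hirr, hs1, hs2⟩ := exists_irrational_btwn (show 1 - 1/(D+1) < 1 by linarith)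
    obtain ⟨C, hC, A, hA, hCm, hAm, hdis⟩ := hcor2 (-s) (by linarith) hirr.neg
    have hw := hAm A0 hA0
    have hA0r : (A0.2 : ℝ) + 1 ≤ A0.1 := by exact_mod_cast hA0'
    have hA0n : (0:ℝ) ≤ A0.2 := by positivity
    have hwA : (1:ℝ) ≤ A.1 - s * A.2 := by nlinarith
    have hAn : (0:ℝ) ≤ A.2 := by positivity
    have hsA : (1 - s) * A.2 < 1 := by
      have := hDU A hA
      nlinarith
    have hAA : A.2 < A.1 := by
      have : (A.2 : ℝ) < A.1 := by nlinarith
      exact_mod_cast this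
    have hCp := hTpos C hC
    have hCC := hT C hC
    rcases hdis with hpar | ⟨ha, hb⟩
    · exfalso
      have : A.2 * C.1 < C.2 * A.1 := by nlinarith
      omega
    · have hA10 : A = (1,0) := by ext <;> simp <;> omega
      have hC01 : C = (0,1) := by
        subst hA10
        ext <;> simp at * <;> omega
      refine ⟨hA10 ▸ hA, ?_⟩
      intro u hu hu1
      have h1 := hCm u hu
      rw [hC01] at h1
      simp only [Nat.cast_zero, Nat.cast_one] at h1
      have h2 : (1:ℝ) ≤ u.1 := by exact_mod_cast hu1
      have h3 : (u.1 : ℝ) + 1 < u.2 := by nlinarith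
      exact_mod_cast h3
  -- step 2
  have hT2 : ∀ u ∈ T, u.1 = 0 := by
    by_contra! hcon
    obtain ⟨u1, hu1, hu1'⟩ := hcon
    obtain ⟨u0, hu0, hmax⟩ := Finset.exists_max_image (T.filter fun u => 1 ≤ u.1)
      (fun u => (u.1 : ℝ) / (u.2 - 1)) ⟨u1, by rw [Finset.mem_filter]; exact ⟨hu1, by omega⟩⟩
    rw [Finset.mem_filter] at hu0
    obtain ⟨hu0T, hu01⟩ := hu0
    have h0r : (u0.1 : ℝ) + 1 < u0.2 := by exact_mod_cast hT1 u0 hu0T hu01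
    have h01r : (1:ℝ) ≤ u0.1 := by exact_mod_cast hu01
    set τ : ℝ := (u0.1 : ℝ) / (u0.2 - 1) with hτ
    have hu0τ : (u0.1 : ℝ) = τ * (u0.2 - 1) := by
      rw [hτ, div_mul_cancel₀]; linarith
    have hτ0 : 0 < τ := div_pos (by linarith) (by linarith)
    have hτ1 : τ < 1 := by rw [hτ, div_lt_one (by linarith)]; linarith
    have hmaxT : ∀ u ∈ T, 1 ≤ u.1 → (u.1 : ℝ) ≤ τ * (u.2 - 1) := by
      intro u hu hu1
      have h1 := hmax u (by rw [Finset.mem_filter]; exact ⟨hu, hu1⟩)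
      have h2 : (u.1 : ℝ) + 1 < u.2 := by exact_mod_cast hT1 u hu hu1
      have h3 : (1:ℝ) ≤ u.1 := by exact_mod_cast hu1
      rwa [div_le_iff₀ (by linarith)] at h1
    have hτD : τ * (1 / (D+1)) ≤ τ := by nlinarith
    obtain ⟨s, hirr, hs1, hs2⟩ := exists_irrational_btwn
      (show τ - τ * (1/(D+1)) < τ by have := mul_pos hτ0 hD2; linarith)
    have hs0 : 0 < s := by linarith
    obtain ⟨C, hC, A, hA, hCm, hAm, hdis⟩ := hcor2 (-s) (by linarith) hirr.neg
    have hCp := hTpos C hC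
    have hwA := hAm (1,0) h10
    simp only [Nat.cast_zero, Nat.cast_one] at hwA
    have hAn : (0:ℝ) ≤ A.2 := by positivity
    have hA1 : (1:ℝ) ≤ A.1 := by nlinarith
    have hA1n : 1 ≤ A.1 := by exact_mod_cast hA1
    have hCpr : (1:ℝ) ≤ C.2 := by exact_mod_cast hCp
    have hCneg : (C.1 : ℝ) - s * C.2 < 0 := by
      by_cases h1 : 1 ≤ C.1
      · have a1 := hmaxT C hC h1
        have a2 := hDT C hC
        have a3 : (τ - s) * C.2 < τ := by
          calc (τ - s) * C.2 ≤ (τ * (1/(D+1))) * D := by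
                apply mul_le_mul (by linarith) a2 (by linarith) (by positivity)
            _ = τ * (1/(D+1) * D) := by ring
            _ < τ * 1 := by apply mul_lt_mul_of_pos_left hD3 hτ0
            _ = τ := mul_one _
        nlinarith
      · have : C.1 = 0 := by omega
        rw [this]
        push_cast
        nlinarith
    have hCu := hCm u0 hu0T
    rcases hdis with hpar | ⟨ha, hb⟩
    · have hparr : (C.2 : ℝ) * A.1 = A.2 * C.1 := by exact_mod_cast hpar
      have e1 : (A.1 : ℝ) * (C.1 - s * C.2) = C.1 * (A.1 - s * A.2) := by
        linear_combination (-s) * hparr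
      have e2 : (0:ℝ) ≤ C.1 * (A.1 - s * A.2) := mul_nonneg (by positivity) (by linarith)
      have e3 : (A.1 : ℝ) * (C.1 - s * C.2) < 0 := mul_neg_of_pos_of_neg (by linarith) hCneg
      linarith
    · have c1 : C.1 = 0 := by omega
      have c2 : C.2 = 1 := by omega
      rw [c1, c2, hu0τ] at hCu
      push_cast at hCu
      nlinarith
  -- step 3
  obtain ⟨s, hirr, hs1, hs2⟩ := exists_irrational_btwn hD2
  obtain ⟨C, hC, A, hA, hCm, hAm, hdis⟩ := hcor2 s (by linarith) hirr
  have hCp := hTpos C hC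
  have hC1 := hT2 C hC
  have hwA := hAm (1,0) h10
  simp only [Nat.cast_zero, Nat.cast_one] at hwA
  have hAn : (0:ℝ) ≤ A.2 := by positivity
  have hsA : s * A.2 < 1 := by
    have := hDU A hA
    nlinarith
  have hA1 : 1 ≤ A.1 := by
    by_contra h
    rw [show A.1 = 0 by omega] at hwA
    push_cast at hwA
    linarith
  have hC2 : C.2 = 1 := by
    rcases hdis with hpar | ⟨ha, hb⟩
    · rw [hC1] at hpar
      simp at hpar
      omega
    · omega
  intro u hu
  have h1 := hT2 u hu
  have h2 := hTpos u hu
  have h3 := hCm u hu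
  rw [h1, hC1, hC2] at h3
  push_cast at h3
  have h4 : (u.2 : ℝ) ≤ 1 := by nlinarith
  have h5 : u.2 ≤ 1 := by exact_mod_cast h4
  exact Prod.ext h1 (by simp; omega)

end Newton
section Explicit

open Polynomial

variable {K : Type} [Field K]

theorem gen_rel {B : Type} [Ring B] [Algebra K B] (x y : B) (h : y * x = x * y + 1) (q e : K)
    (hq : q ≠ 0) (z : B) (hz : z = q⁻¹ • (y - algebraMap K B e)) (g : K[X]) :
    z * (q • (x - aeval z g)) = (q • (x - aeval z g)) * z + 1 := by
  have h1 : z * aeval z g = aeval z g * z := by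
    have := congrArg (aeval (R := K) z) (mul_comm X g)
    simpa using this
  have h2 : z * (q • x) = (q • x) * z + 1 := by
    rw [hz, smul_mul_smul_comm, smul_mul_smul_comm, inv_mul_cancel₀ hq, mul_inv_cancel₀ hq, one_smul,
      one_smul, sub_mul, mul_sub, h, Algebra.commutes e x]
    abel
  rw [smul_sub, mul_sub, h2, sub_mul, mul_smul_comm, h1, smul_mul_assoc q (aeval z g) z]
  abel

theorem gen_sub {B : Type} [Ring B] [Algebra K B] (P Q : B) (h : Q * P = P * Q + 1) (a : K) :
    (Q - a • (1 : B)) * P = P * (Q - a • (1 : B)) + 1 := by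
  rw [sub_mul, mul_sub, h, smul_mul_assoc, mul_smul_comm, one_mul, mul_one]
  abel

theorem gen_comm {B : Type} [Ring B] [Algebra K B] (P x y : B) (q : K) (hq : q ≠ 0)
    (h : (q • y) * P = P * (q • y) + 1) (hxy : y * x = x * y + 1) :
    y * (P - q⁻¹ • x) = (P - q⁻¹ • x) * y := by
  have h1 : y * P = P * y + q⁻¹ • (1 : B) := by
    have := congrArg (fun z => q⁻¹ • z) h
    simpa [smul_add, smul_smul, inv_mul_cancel₀ hq] using this
  rw [mul_sub, sub_mul, h1, mul_smul_comm, hxy, smul_mul_assoc, smul_add]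
  abel

variable [CharZero K]

theorem y_comm (r : ℕ × ℕ →₀ K) (h : Wy K * Φ K r = Φ K r * Wy K) :
    ∀ u ∈ r.support, u.1 = 0 := by
  intro u hu
  by_contra hne
  have hy : Wy K = Φ K (Finsupp.single (0,1) 1) := by simp [Φ, mon]
  have hk := kap_comm (K := K) (Finsupp.single (0,1) 1) r (u.1 - 1, u.2)
  rw [← hy, h, sub_self, Finsupp.support_single _ one_ne_zero, Finset.sum_singleton,
    Finset.sum_eq_single u] at hk
  · rw [bkt_one _ _ _ (by simp; omega) (by simp; omega)] at hk
    have h1 := Finsupp.mem_support_iff.mp hu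
    have h2 : (u.1 : K) ≠ 0 := by exact_mod_cast hne
    simp at hk
    tauto
  · intro v hv hvu
    have : bkt K (u.1 - 1, u.2) (0,1) v = 0 := by
      by_contra hb
      obtain ⟨n, hn, h1, h2⟩ := bkt_ne _ _ _ hb
      simp only at h1 h2
      apply hb
      have hn1 : n ≠ 1 := by
        rintro rfl
        apply hvu
        ext <;> omega
      unfold bkt
      rw [mmc_eq _ _ _ n (by simp only; omega) (by simp only; omega),
        mmc_eq _ _ _ n (by simp only; omega) (by simp only; omega)]
      unfold nc
      simp only
      rw [Nat.choose_eq_zero_of_lt (n := 1) (by omega), Nat.choose_eq_zero_of_lt (n := 0) (by omega)]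
      simp
    rw [this, mul_zero]
  · intro hh; exact absurd hu hh

theorem one_ne : (1 : Weyl K) ≠ 0 := by
  intro h
  have h1 : kap K (mon K (0,0)) = 0 := by
    rw [show mon K (0,0) = 1 by simp [mon], h, map_zero]
  rw [kap_mon] at h1
  simp at h1

theorem act_const (c : ℕ × ℕ →₀ K) (h : ∀ u ∈ c.support, u.1 ≤ u.2) :
    ∃ a : K, act K (Φ K c) 1 = C a := by
  suffices act K (Φ K c) 1 ∈ LinearMap.range (Polynomial.monomial (R := K) 0) by
    obtain ⟨a, ha⟩ := this
    exact ⟨a, ha.symm⟩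
  rw [act_Φ]
  refine Submodule.sum_mem _ fun u hu => Submodule.smul_mem _ _ ?_
  have h1 := h u hu
  have h2 := act_mon_X (R := K) u 0
  rw [pow_zero] at h2
  rw [h2]
  by_cases h3 : u.2 = 0
  · refine ⟨1, ?_⟩
    rw [h3, show u.1 = 0 by omega]
    simp
  · rw [Nat.descFactorial_eq_zero_iff_lt.mpr (by omega)]
    simp

theorem main_form (P Q : Weyl K) (h : Q * P = P * Q + 1)
    (hQ : bet K Q = MulOpposite.op (-Q)) :
    ∃ (q e : K) (g : K[X]), q ≠ 0 ∧ Q = q • Wy K + algebraMap K (Weyl K) e ∧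
      P = q⁻¹ • Wx K + aeval (Wy K) g := by
  classical
  let c := kap K Q
  let r := kap K P
  have hc : Φ K c = Q := Φ_kap Q
  have hr : Φ K r = P := Φ_kap P
  have hle : ∀ u ∈ c.support, u.1 ≤ u.2 := by
    apply support_le P c
    · rw [hc]; exact h
    · rw [hc]; exact hQ
  let c' := c.erase (0,0)
  have hc' : Φ K c' = Q - c (0,0) • (1 : Weyl K) := by
    have h1 : Finsupp.single (0,0) (c (0,0)) + c' = c := Finsupp.single_add_erase _ _
    have h2 := congrArg (Φ K) h1
    rw [map_add, hc] at h2
    have h3 : Φ K (Finsupp.single (0,0) (c (0,0))) = c (0,0) • (1 : Weyl K) := by simp [Φ, mon]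
    rw [h3] at h2
    rw [← h2]
    exact (add_sub_cancel_left _ _).symm
  have hrel : Φ K c' * Φ K r = Φ K r * Φ K c' + 1 := by
    rw [hc', hr]; exact gen_sub P Q h _
  have hc'le : ∀ u ∈ c'.support, u.1 ≤ u.2 := by
    intro u hu
    apply hle
    rw [Finsupp.support_erase] at hu
    exact Finset.mem_of_mem_erase hu
  have hTne : c'.support.Nonempty := by
    rw [Finset.nonempty_iff_ne_empty]
    intro h0
    rw [Finsupp.support_eq_empty.mp h0, map_zero, zero_mul, mul_zero, zero_add] at hrel
    exact one_ne hrel.symm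
  obtain ⟨A0, hA0, hA0'⟩ : ∃ A0 ∈ r.support, A0.2 < A0.1 := by
    by_contra! hcon
    obtain ⟨a, ha⟩ := act_const r hcon
    obtain ⟨b, hb⟩ := act_const c' hc'le
    have h1 : act K (Φ K c' * Φ K r) 1 = act K (Φ K r * Φ K c' + 1) 1 := by rw [hrel]
    rw [map_mul, map_add, map_mul, map_one (act K), LinearMap.add_apply, Module.End.mul_apply,
      Module.End.mul_apply, ha, hb, Module.End.one_apply] at h1
    rw [show (C a : K[X]) = a • 1 by simp [smul_eq_C_mul],
      show (C b : K[X]) = b • 1 by simp [smul_eq_C_mul], map_smul, map_smul, ha, hb,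
      smul_eq_C_mul, smul_eq_C_mul, mul_comm] at h1
    exact one_ne_zero (α := K[X]) (by linear_combination -h1)
  have hN := newton r.support c'.support (by simp [c']) hc'le hTne A0 hA0 hA0'
    (fun s hs C hC A hA h1 h2 => corner c' r hrel s hs C A hC hA h1 h2)
  obtain ⟨u, hu⟩ := hTne
  have hu1 := hN u hu
  subst hu1
  have hq : c' (0,1) ≠ 0 := Finsupp.mem_support_iff.mp hu
  have hc1 : c' = Finsupp.single (0,1) (c' (0,1)) := by
    ext v
    rw [Finsupp.single_apply]
    split_ifs with hv
    · rw [hv]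
    · by_contra hne
      exact hv (hN v (Finsupp.mem_support_iff.mpr hne)).symm
  have hy : Φ K c' = c' (0,1) • Wy K := by
    rw [hc1]; simp [Φ, mon]
  set q := c' (0,1) with hqdef
  have hrel2 := hrel
  rw [hy, hr] at hrel2
  have hcomm := gen_comm P (Wx K) (Wy K) q hq hrel2 (W_rel K)
  have hsup := y_comm (kap K (P - q⁻¹ • Wx K)) (by rw [Φ_kap]; exact hcomm)
  have hmem : P - q⁻¹ • Wx K ∈ Subalgebra.toSubmodule (aeval (R := K) (Wy K)).range := by
    rw [← Φ_kap (P - q⁻¹ • Wx K)]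
    simp only [Φ, Finsupp.linearCombination_apply]
    refine Submodule.sum_mem _ fun u hu => Submodule.smul_mem _ _ ?_
    refine ⟨X ^ u.2, ?_⟩
    have := hsup u hu
    simp [mon, this]
  obtain ⟨g, hg⟩ := hmem
  refine ⟨q, c (0,0), g, hq, ?_, ?_⟩
  · rw [← hy, hc', Algebra.algebraMap_eq_smul_one]
    exact (sub_add_cancel _ _).symm
  · have hg2 : aeval (Wy K) g = P - q⁻¹ • Wx K := hg
    rw [hg2]
    exact (add_sub_cancel _ _).symm

theorem gen1 {B : Type} [Ring B] [Algebra K B] (q e : K) (hq : q ≠ 0) (y Q : B)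
    (hQ : Q = q • y + algebraMap K B e) : q⁻¹ • (Q - algebraMap K B e) = y := by
  rw [hQ, add_sub_cancel_right, smul_smul, inv_mul_cancel₀ hq, one_smul]

theorem gen2 {B : Type} [Ring B] [Algebra K B] (q : K) (hq : q ≠ 0) (x P t : B)
    (hP : P = q⁻¹ • x + t) : q • (P - t) = x := by
  rw [hP, add_sub_cancel_right, smul_smul, mul_inv_cancel₀ hq, one_smul]

theorem gen3 {B : Type} [Ring B] [Algebra K B] (q : K) (hq : q ≠ 0) (x t : B) :
    q⁻¹ • (q • (x - t)) + t = x := by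
  rw [smul_smul, inv_mul_cancel₀ hq, one_smul, sub_add_cancel]

theorem gen4 {B : Type} [Ring B] [Algebra K B] (q e : K) (hq : q ≠ 0) (y : B) :
    q • (q⁻¹ • (y - algebraMap K B e)) + algebraMap K B e = y := by
  rw [smul_smul, mul_inv_cancel₀ hq, one_smul, sub_add_cancel]

theorem bij_main (φ : Weyl K →ₐ[K] Weyl K)
    (hQ : bet K (φ (Wy K)) = MulOpposite.op (-φ (Wy K))) : Function.Bijective φ := by
  obtain ⟨q, e, g, hq, hy, hx⟩ := main_form (φ (Wx K)) (φ (Wy K)) (by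
    rw [← map_mul, W_rel, map_add, map_mul, map_one]) hQ
  obtain ⟨z, hz⟩ : ∃ z, z = q⁻¹ • (Wy K - algebraMap K (Weyl K) e) := ⟨_, rfl⟩
  let ψ : Weyl K →ₐ[K] Weyl K := Wlift (q • (Wx K - aeval z g)) z
    (gen_rel (Wx K) (Wy K) (W_rel K) q e hq z hz g)
  have hψx : ψ (Wx K) = q • (Wx K - aeval z g) := Wlift_x _ _ _
  have hψy : ψ (Wy K) = z := Wlift_y _ _ _
  have hφz : φ z = Wy K := by
    rw [hz, map_smul, map_sub, AlgHom.commutes]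
    exact gen1 q e hq _ _ hy
  have h1 : φ.comp ψ = AlgHom.id K _ := by
    apply W_ext
    · rw [AlgHom.comp_apply, hψx, map_smul, map_sub, ← Polynomial.aeval_algHom_apply, hφz]
      exact gen2 q hq _ _ _ hx
    · rw [AlgHom.comp_apply, hψy, hφz]; rfl
  have h2 : ψ.comp φ = AlgHom.id K _ := by
    apply W_ext
    · rw [AlgHom.comp_apply, hx, map_add, map_smul, ← Polynomial.aeval_algHom_apply, hψx, hψy]
      exact gen3 q hq _ _
    · rw [AlgHom.comp_apply, hy, map_add, map_smul, AlgHom.commutes, hψy, hz]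
      exact gen4 q e hq _
  refine Function.bijective_iff_has_inverse.mpr ⟨ψ, ?_, ?_⟩
  · intro a; exact DFunLike.congr_fun h2 a
  · intro a; exact DFunLike.congr_fun h1 a

end Explicit
section Reduction

variable {K : Type} [Field K]

/-- bundle an endomorphism -/
def mkHom {A : Type} [Ring A] [Algebra K A] (f : A → A) (hf : IsAlgEndo K f) : A →ₐ[K] A :=
  AlgHom.ofLinearMap { toFun := f, map_add' := hf.1, map_smul' := hf.2.1 } hf.2.2.2 hf.2.2.1

/-- bundle an anti-endomorphism -/
def mkAnti {A : Type} [Ring A] [Algebra K A] (f : A → A) (hf : IsAntiEndo K f) : A →ₐ[K] Aᵐᵒᵖ :=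
  AlgHom.ofLinearMap
    { toFun := fun a => MulOpposite.op (f a)
      map_add' := fun a b => by rw [hf.1, MulOpposite.op_add]
      map_smul' := fun c a => by rw [hf.2.1, MulOpposite.op_smul, RingHom.id_apply] }
    (by change MulOpposite.op (f 1) = 1; rw [hf.2.2.2]; rfl)
    (fun a b => by
      change MulOpposite.op (f (a * b)) = MulOpposite.op (f a) * MulOpposite.op (f b)
      rw [hf.2.2.1, MulOpposite.op_mul])

theorem mkHom_apply {A : Type} [Ring A] [Algebra K A] (f : A → A) (hf : IsAlgEndo K f) (a : A) :
    mkHom f hf a = f a := rfl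

theorem mkAnti_apply {A : Type} [Ring A] [Algebra K A] (f : A → A) (hf : IsAntiEndo K f) (a : A) :
    mkAnti f hf a = MulOpposite.op (f a) := rfl

theorem conj_norm (α γ : Weyl K → Weyl K) (hα : IsInvolutionOn K α) (h : ConjToAlpha K α γ) :
    ∃ g : Weyl K ≃ₐ[K] Weyl K, ∀ a, g (γ a) = α (g a) := by
  obtain ⟨g, hg, hγ⟩ := h
  have hbij : Function.Bijective g := by
    rcases hg with hg | hg
    · exact hg.2
    · exact hg.2
  have hgγ : ∀ a, g (γ a) = α (g a) := by
    intro a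
    rw [hγ]
    exact Function.invFun_eq (hbij.2 _)
  rcases hg with hg | hg
  · exact ⟨AlgEquiv.ofBijective (mkHom g hg.1) hbij, hgγ⟩
  · have hend : IsAlgEndo K (α ∘ g) := by
      refine ⟨?_, ?_, ?_, ?_⟩
      · intro a b
        rw [Function.comp_apply, hg.1.1, hα.1.1.1]; rfl
      · intro c a
        rw [Function.comp_apply, hg.1.2.1, hα.1.1.2.1]; rfl
      · intro a b
        rw [Function.comp_apply, hg.1.2.2.1, hα.1.1.2.2.1]; rfl
      · rw [Function.comp_apply, hg.1.2.2.2, hα.1.1.2.2.2]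
    refine ⟨AlgEquiv.ofBijective (mkHom (α ∘ g) hend) (hα.1.2.comp hbij), ?_⟩
    intro a
    change α (g (γ a)) = α (α (g a))
    rw [hgγ]

theorem theta_rel {B : Type} [Ring B] [Algebra K B] [CharZero K] (x y : B) (h : y * x = x * y + 1) :
    ((2⁻¹ : K) • (y - x)) * (x + y) = (x + y) * ((2⁻¹ : K) • (y - x)) + 1 := by
  have h2 : (y - x) * (x + y) = (x + y) * (y - x) + (2 : K) • (1 : B) := by
    rw [two_smul]
    simp only [sub_mul, mul_add, mul_sub, add_mul, h]
    abel
  rw [smul_mul_assoc, mul_smul_comm, h2, smul_add, smul_smul, inv_mul_cancel₀ two_ne_zero, one_smul]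

theorem theta_rel2 {B : Type} [Ring B] [Algebra K B] [CharZero K] (x y : B) (h : y * x = x * y + 1) :
    ((2⁻¹ : K) • x + y) * ((2⁻¹ : K) • x - y) = ((2⁻¹ : K) • x - y) * ((2⁻¹ : K) • x + y) + 1 := by
  have h3 : (2⁻¹ : K) • (1 : B) + (2⁻¹ : K) • (1 : B) = 1 := by
    rw [← add_smul, show (2⁻¹ : K) + 2⁻¹ = 1 by norm_num, one_smul]
  simp only [sub_mul, mul_add, mul_sub, add_mul, mul_smul_comm, smul_mul_assoc, h, smul_add, smul_sub]
  generalize (2⁻¹ : K) • (1 : B) = w at h3 ⊢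
  generalize (2⁻¹ : K) • (x * y) = w2
  rw [← h3]
  abel

theorem th1 {B : Type} [Ring B] [Algebra K B] [CharZero K] (x y : B) :
    (2⁻¹ : K) • (x + y) - (2⁻¹ : K) • (y - x) = x := by
  rw [← smul_sub, show x + y - (y - x) = (2:K) • x by rw [two_smul]; abel, smul_smul,
    inv_mul_cancel₀ two_ne_zero, one_smul]

theorem th2 {B : Type} [Ring B] [Algebra K B] [CharZero K] (x y : B) :
    (2⁻¹ : K) • (x + y) + (2⁻¹ : K) • (y - x) = y := by
  rw [← smul_add, show x + y + (y - x) = (2:K) • y by rw [two_smul]; abel, smul_smul,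
    inv_mul_cancel₀ two_ne_zero, one_smul]

theorem th3 {B : Type} [Ring B] [Algebra K B] [CharZero K] (x y : B) :
    ((2⁻¹ : K) • x - y) + ((2⁻¹ : K) • x + y) = x := by
  rw [show ((2⁻¹ : K) • x - y) + ((2⁻¹ : K) • x + y) = (2⁻¹ : K) • x + (2⁻¹ : K) • x by abel,
    ← add_smul, show (2⁻¹ : K) + 2⁻¹ = 1 by norm_num, one_smul]

theorem th4 {B : Type} [Ring B] [Algebra K B] [CharZero K] (x y : B) :
    (2⁻¹ : K) • (((2⁻¹ : K) • x + y) - ((2⁻¹ : K) • x - y)) = y := by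
  rw [show ((2⁻¹ : K) • x + y) - ((2⁻¹ : K) • x - y) = (2:K) • y by rw [two_smul]; abel, smul_smul,
    inv_mul_cancel₀ two_ne_zero, one_smul]

theorem th5 {B : Type} [Ring B] [Algebra K B] (x y : B) :
    (2⁻¹ : K) • (x - y) = -((2⁻¹ : K) • (y - x)) := by
  rw [← smul_neg, neg_sub]

variable [CharZero K]

/-- the rotation -/
def theta (K : Type) [Field K] [CharZero K] : Weyl K ≃ₐ[K] Weyl K :=
  AlgEquiv.ofAlgHom
    (Wlift (Wx K + Wy K) ((2⁻¹ : K) • (Wy K - Wx K)) (theta_rel _ _ (W_rel K)))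
    (Wlift ((2⁻¹ : K) • Wx K - Wy K) ((2⁻¹ : K) • Wx K + Wy K) (theta_rel2 _ _ (W_rel K)))
    (by
      apply W_ext
      · rw [AlgHom.comp_apply, Wlift_x, map_sub, map_smul, Wlift_x, Wlift_y]
        exact th1 _ _
      · rw [AlgHom.comp_apply, Wlift_y, map_add, map_smul, Wlift_x, Wlift_y]
        exact th2 _ _)
    (by
      apply W_ext
      · rw [AlgHom.comp_apply, Wlift_x, map_add, Wlift_x, Wlift_y]
        exact th3 (K := K) _ _
      · rw [AlgHom.comp_apply, Wlift_y, map_smul, map_sub, Wlift_x, Wlift_y]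
        exact th4 _ _)

theorem theta_x : theta K (Wx K) = Wx K + Wy K := Wlift_x _ _ _
theorem theta_y : theta K (Wy K) = (2⁻¹ : K) • (Wy K - Wx K) := Wlift_y _ _ _

theorem anti_sub {A : Type} [Ring A] [Algebra K A] (f : A → A) (hf : IsAntiEndo K f) (a b : A) :
    f (a - b) = f a - f b := by
  have := map_sub (mkAnti f hf) a b
  exact congrArg MulOpposite.unop this

theorem alpha_theta_y (α : Weyl K → Weyl K) (hα : IsExchange K α) :
    α (theta K (Wy K)) = -theta K (Wy K) := by
  rw [theta_y, hα.1.1.1.2.1, anti_sub α hα.1.1.1, hα.2.1, hα.2.2]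
  exact th5 _ _

theorem alpha_theta (α : Weyl K → Weyl K) (hα : IsExchange K α) (a : Weyl K) :
    α (theta K a) = theta K (MulOpposite.unop (bet K a)) := by
  have h : (mkAnti α hα.1.1.1).comp (theta K : Weyl K →ₐ[K] Weyl K)
      = (AlgHom.op (theta K : Weyl K →ₐ[K] Weyl K)).comp (bet K) := by
    apply W_ext
    · apply MulOpposite.unop_injective
      have hb : bet K (Wx K) = MulOpposite.op (Wx K) := Wlift_x _ _ _
      rw [AlgHom.comp_apply, AlgHom.comp_apply, hb, mkAnti_apply]
      change α (theta K (Wx K)) = theta K (Wx K)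
      rw [theta_x, hα.1.1.1.1, hα.2.1, hα.2.2, add_comm]
    · apply MulOpposite.unop_injective
      have hb : bet K (Wy K) = MulOpposite.op (-Wy K) := Wlift_y _ _ _
      rw [AlgHom.comp_apply, AlgHom.comp_apply, hb, mkAnti_apply]
      change α (theta K (Wy K)) = theta K (-Wy K)
      rw [map_neg]
      exact alpha_theta_y α hα
  exact congrArg MulOpposite.unop (DFunLike.congr_fun h a)

end Reduction

/-- an endomorphism `f` of `A₁` intertwining two involutions, each conjugate
to the exchange involution `α`, is an automorphism. -/
theorem stmt_1 {K : Type} [Field K] [CharZero K]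
    (α f : Weyl K → Weyl K) (hα : IsExchange K α) (hf : IsAlgEndo K f)
    (γ δ : Weyl K → Weyl K)
    (hγ : IsInvolutionOn K γ) (hγα : ConjToAlpha K α γ)
    (hδ : IsInvolutionOn K δ) (hδα : ConjToAlpha K α δ)
    (hfγδ : f ∘ γ = δ ∘ f) :
    IsAlgAuto K f := by
  obtain ⟨g1, hg1⟩ := conj_norm α γ hα.1 hγα
  obtain ⟨g2, hg2⟩ := conj_norm α δ hα.1 hδα
  have hcomm : ∀ a, f (γ a) = δ (f a) := fun a => congrFun hfγδ a
  let F : Weyl K →ₐ[K] Weyl K := mkHom f hf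
  let F1 : Weyl K →ₐ[K] Weyl K :=
    (g2 : Weyl K →ₐ[K] Weyl K).comp (F.comp (g1.symm : Weyl K →ₐ[K] Weyl K))
  have hF1 : ∀ a, F1 a = g2 (f (g1.symm a)) := fun a => rfl
  have hF1α : ∀ a, F1 (α a) = α (F1 a) := by
    intro a
    obtain ⟨b, rfl⟩ := g1.surjective a
    rw [← hg1, hF1, hF1, g1.symm_apply_apply, g1.symm_apply_apply, hcomm, hg2]
  let F2 : Weyl K →ₐ[K] Weyl K :=
    ((theta K).symm : Weyl K →ₐ[K] Weyl K).comp (F1.comp (theta K : Weyl K →ₐ[K] Weyl K))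
  have hF2 : ∀ a, theta K (F2 a) = F1 (theta K a) := fun a => (theta K).apply_symm_apply _
  have hb : Function.Bijective F2 := by
    apply bij_main
    apply MulOpposite.unop_injective
    apply (theta K).injective
    rw [← alpha_theta α hα, MulOpposite.unop_op, map_neg, hF2, ← hF1α, alpha_theta_y α hα, map_neg]
  have hfF : f = g2.symm ∘ theta K ∘ F2 ∘ (theta K).symm ∘ g1 := by
    funext a
    simp only [Function.comp_apply]
    rw [hF2, AlgEquiv.apply_symm_apply, hF1, g1.symm_apply_apply, g2.symm_apply_apply]
  refine ⟨hf, ?_⟩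
  rw [hfF]
  exact g2.symm.bijective.comp ((theta K).bijective.comp (hb.comp
    ((theta K).symm.bijective.comp g1.bijective)))
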